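/- arXiv:2401.08377 — 2 statements merged into one kernel-verified Lean document; each statement's English description precedes it below -/
import Mathlib

section
/- Let 𝒜, ℬ be open MDPs and let (L^𝒜,U^𝒜), (L^ℬ,U^ℬ) be sound approximations of 𝒜 and ℬ. Define L^{𝒜⊕ℬ} := (A^{D(L^𝒜)⊕D(L^ℬ)}(i))_i and U^{𝒜⊕ℬ} := (A^{D(U^𝒜)⊕D(U^ℬ)}(i))_i, indexed by the entrances of 𝒜⊕ℬ. Then gap_∞(L^{𝒜⊕ℬ}, U^{𝒜⊕ℬ}) ≤ max( gap_∞(L^𝒜, U^𝒜), gap_∞(L^ℬ, U^ℬ) ). -/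
open scoped Classical ENNReal

namespace SD

/-- A Markov decision process with finite sets of states and actions: a partial
transition function assigning to a state and an action a probability
distribution over states. -/
structure MDP (S A : Type) : Type where
  P : S → A → Option (S → ℝ)

namespace MDP

variable {S A : Type} [Fintype S] [Fintype A]

/-- All defined transitions are genuine probability distributions. -/
def Proper (M : MDP S A) : Prop :=
  ∀ s a d, M.P s a = some d → (∀ s', 0 ≤ d s') ∧ ∑ s', d s' = 1

/-- The action `a` is enabled in `s`. -/
def enabled (M : MDP S A) (s : S) (a : A) : Prop := M.P s a ≠ none

/-- A state is terminal if no action is enabled in it. -/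
def terminal (M : MDP S A) (s : S) : Prop := ∀ a, M.P s a = none

/-- Transition probabilities. -/
noncomputable def prob (M : MDP S A) (s : S) (a : A) (s' : S) : ℝ :=
  (M.P s a).elim 0 fun d => d s'

end MDP

/-- A finite path of an MDP: a start state with a list of (action, next state) steps. -/
structure FinPath (S A : Type) : Type where
  start : S
  steps : List (A × S)

namespace FinPath

/-- The last state of a finite path. -/
def last {S A : Type} (π : FinPath S A) : S := (π.steps.map Prod.snd).getLastD π.start

/-- Extending a finite path by one step. -/
def snoc {S A : Type} (π : FinPath S A) (a : A) (s : S) : FinPath S A :=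
  ⟨π.start, π.steps ++ [(a, s)]⟩

end FinPath

namespace MDP

variable {S A : Type} [Fintype S] [Fintype A]

/-- Consistency of a sequence of steps with the transitions, from a given state. -/
def ConsistentFrom (M : MDP S A) : S → List (A × S) → Prop
  | _, [] => True
  | s, (a, s') :: l => M.prob s a s' ≠ 0 ∧ ConsistentFrom M s' l

/-- A finite path is consistent if every step has nonzero probability. -/
def Consistent (M : MDP S A) (π : FinPath S A) : Prop := M.ConsistentFrom π.start π.steps

end MDP

/-- A (history-dependent, stochastic) scheduler, given by its raw weights. -/
abbrev Sched (S A : Type) : Type := FinPath S A → A → ℝ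

namespace MDP

variable {S A : Type} [Fintype S] [Fintype A]

/-- `σ` is a scheduler for `M`: it assigns to every (consistent) finite path a
probability distribution over the actions enabled in its last state. -/
def IsSched (M : MDP S A) (σ : Sched S A) : Prop :=
  ∀ π : FinPath S A, M.Consistent π →
    (∀ a, 0 ≤ σ π a) ∧ (∀ a, σ π a ≠ 0 → M.enabled π.last a) ∧
      (¬M.terminal π.last → ∑ a, σ π a = 1)

end MDP

/-- Memoryless schedulers depend only on the last state of a path. -/
def Memoryless {S A : Type} (σ : Sched S A) : Prop :=
  ∀ π π' : FinPath S A, π.last = π'.last → σ π = σ π'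

/-- Deterministic schedulers choose Dirac distributions. -/
def Deterministic {S A : Type} (σ : Sched S A) : Prop := ∀ π a, σ π a = 0 ∨ σ π a = 1

/-- Deterministic memoryless (DM) schedulers. -/
def DM {S A : Type} (σ : Sched S A) : Prop := Memoryless σ ∧ Deterministic σ

namespace MDP

variable {S A : Type} [Fintype S] [Fintype A]

/-- Probability of visiting `T` within `n` steps (terminal states made absorbing),
starting from the history `π`, under the scheduler `σ`. -/
noncomputable def reachN (M : MDP S A) (σ : Sched S A) (T : Set S) :
    ℕ → FinPath S A → ℝ
  | 0, π => if π.last ∈ T then 1 else 0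
  | n + 1, π =>
      if π.last ∈ T then 1
      else ∑ a : A, σ π a * ∑ s' : S, M.prob π.last a s' * reachN M σ T n (π.snoc a s')

/-- `Pr^{M,σ}(s ⊨ ◇T)`: the probability, under the measure on infinite paths induced
by `σ` from `s` (terminal states made absorbing), of the paths that visit `T`; it is
the supremum of the bounded-horizon reachability probabilities. -/
noncomputable def Pr (M : MDP S A) (σ : Sched S A) (s : S) (T : Set S) : ℝ :=
  ⨆ n : ℕ, M.reachN σ T n ⟨s, []⟩

end MDP

/-- An open MDP: an MDP together with (totally ordered, given as lists) sets of
rightward/leftward entrances and exits. -/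
structure OMDP (S A : Type) : Type where
  M : MDP S A
  Ir : List S
  Il : List S
  Or : List S
  Ol : List S

namespace OMDP

variable {S A : Type}

/-- The entrances `I = I_r ∪ I_l`. -/
def entr (𝒜 : OMDP S A) : List S := 𝒜.Ir ++ 𝒜.Il

/-- The exits `O = O_r ∪ O_l`. -/
def exit (𝒜 : OMDP S A) : List S := 𝒜.Or ++ 𝒜.Ol

/-- The index type of exits. -/
abbrev ExitIdx (𝒜 : OMDP S A) : Type := {s : S // s ∈ 𝒜.exit}

/-- The index type of entrances. -/
abbrev EntrIdx (𝒜 : OMDP S A) : Type := {s : S // s ∈ 𝒜.entr}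

variable [Fintype S] [Fintype A]

/-- Well-formedness of an open MDP: the transitions are probability
distributions, the open ends are pairwise disjoint (each without duplicates),
and the exits are exactly the terminal states. -/
def WF (𝒜 : OMDP S A) : Prop :=
  𝒜.M.Proper ∧ (𝒜.Ir ++ 𝒜.Il ++ 𝒜.Or ++ 𝒜.Ol).Nodup ∧
    ∀ s : S, s ∈ 𝒜.exit ↔ 𝒜.M.terminal s

/-- `Pr^{𝒜,σ}(i ⊨ ◇O) ∈ ℝ^O`: the vector of reachability probabilities to each exit. -/
noncomputable def prVec (𝒜 : OMDP S A) (σ : Sched S A) (i : S) : 𝒜.ExitIdx → ℝ :=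
  fun j => 𝒜.M.Pr σ i {j.1}

/-- The set `A^𝒜(i)` of achievable points from `i`. -/
def achievable (𝒜 : OMDP S A) (i : S) : Set (𝒜.ExitIdx → ℝ) :=
  {p | ∃ σ : Sched S A, 𝒜.M.IsSched σ ∧ p ≤ 𝒜.prVec σ i}

/-- The set `A^{𝒜,Σ}(i)` of points achievable from `i` by schedulers in the class `C`. -/
def achievableBy (𝒜 : OMDP S A) (i : S) (C : Sched S A → Prop) : Set (𝒜.ExitIdx → ℝ) :=
  {p | ∃ σ : Sched S A, 𝒜.M.IsSched σ ∧ C σ ∧ p ≤ 𝒜.prVec σ i}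

/-- The Pareto curve `𝒮(𝒜, i)`: achievable points not strictly dominated by an
achievable point. -/
def pareto (𝒜 : OMDP S A) (i : S) : Set (𝒜.ExitIdx → ℝ) :=
  {p | p ∈ 𝒜.achievable i ∧ ∀ q ∈ 𝒜.achievable i, p ≤ q → q = p}

end OMDP

/-- Downward closure. -/
def dw {ι : Type} (X : Set (ι → ℝ)) : Set (ι → ℝ) := {p | ∃ q ∈ X, p ≤ q}

/-- Downward convex closure. -/
def dwConv {ι : Type} (X : Set (ι → ℝ)) : Set (ι → ℝ) := dw (convexHull ℝ X)

/-- Subdistributions on `ι`: nonnegative points with coordinate sum at most 1. -/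
def Subdist {ι : Type} [Fintype ι] (p : ι → ℝ) : Prop :=
  (∀ j, 0 ≤ p j) ∧ ∑ j, p j ≤ 1

end SD

namespace SD

namespace OMDP

variable {S A : Type} [Fintype S] [Fintype A]

/-- The actions of a shortcut oMDP for the family `B`: the union of the `B i`. -/
abbrev ShortAct (𝒜 : OMDP S A) (B : 𝒜.EntrIdx → Finset (𝒜.ExitIdx → ℝ)) : Type :=
  {p : 𝒜.ExitIdx → ℝ // ∃ i, p ∈ B i}

noncomputable instance instFintypeShortAct (𝒜 : OMDP S A)
    (B : 𝒜.EntrIdx → Finset (𝒜.ExitIdx → ℝ)) : Fintype (ShortAct 𝒜 B) := by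
  have h : {p : 𝒜.ExitIdx → ℝ | ∃ i, p ∈ B i}.Finite := by
    have he : {p : 𝒜.ExitIdx → ℝ | ∃ i, p ∈ B i} =
        ⋃ i, ((B i : Finset (𝒜.ExitIdx → ℝ)) : Set (𝒜.ExitIdx → ℝ)) := by
      ext p; simp
    rw [he]
    exact Set.finite_iUnion fun i => (B i).finite_toSet
  exact h.fintype

/-- The shortcut oMDP `D(B)` of a family `B = (B_i)_{i ∈ I}` of finite sets of
subdistributions on the exits: states are the entrances and exits of `𝒜`
together with a fresh sink `⋆` (encoded by `Option S`, with `⋆ = none`), actions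
are the points in the `B_i`, and from entrance `i` the action `p ∈ B_i` moves to
exit `o` with probability `p(o)` and to `⋆` with the remaining probability
`1 - Σ_o p(o)`. -/
noncomputable def shortcut (𝒜 : OMDP S A) (B : 𝒜.EntrIdx → Finset (𝒜.ExitIdx → ℝ)) :
    OMDP (Option S) (ShortAct 𝒜 B) where
  M := ⟨fun t a =>
    match t with
    | none => none
    | some s =>
        if _h : ∃ hs : s ∈ 𝒜.entr, a.1 ∈ B ⟨s, hs⟩ then
          some fun t' =>
            match t' with
            | none => 1 - ∑ j : 𝒜.ExitIdx, a.1 j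
            | some s' => ∑ j : 𝒜.ExitIdx, if j.1 = s' then a.1 j else 0
        else none⟩
  Ir := 𝒜.Ir.map some
  Il := 𝒜.Il.map some
  Or := 𝒜.Or.map some
  Ol := 𝒜.Ol.map some

end OMDP

/-- Transporting points in `ℝ^{O_𝒴}` to points in `ℝ^{O_𝒳}` along a map of exits. -/
def pullExit {S₁ A₁ S₂ A₂ : Type} (𝒳 : OMDP S₁ A₁) (𝒴 : OMDP S₂ A₂) (f : S₁ → S₂)
    (hf : ∀ s ∈ 𝒳.exit, f s ∈ 𝒴.exit) (p : 𝒴.ExitIdx → ℝ) : 𝒳.ExitIdx → ℝ :=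
  fun j => p ⟨f j.1, hf j.1 j.2⟩

end SD

namespace SD

namespace OMDP

variable {S₁ A₁ S₂ A₂ : Type}

/-- The sum `𝒜 ⊕ ℬ` of open MDPs: the disjoint union of the two oMDPs, with
transitions inherited from each component (and none between components), and
open ends the concatenations of the respective open ends. -/
def sumComp (𝒜 : OMDP S₁ A₁) (ℬ : OMDP S₂ A₂) : OMDP (S₁ ⊕ S₂) (A₁ ⊕ A₂) where
  M := ⟨fun t a =>
    match t, a with
    | Sum.inl s, Sum.inl a => (𝒜.M.P s a).map fun d => Sum.elim d fun _ => 0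
    | Sum.inr s, Sum.inr a => (ℬ.M.P s a).map fun d => Sum.elim (fun _ => 0) d
    | _, _ => none⟩
  Ir := 𝒜.Ir.map Sum.inl ++ ℬ.Ir.map Sum.inr
  Il := 𝒜.Il.map Sum.inl ++ ℬ.Il.map Sum.inr
  Or := 𝒜.Or.map Sum.inl ++ ℬ.Or.map Sum.inr
  Ol := 𝒜.Ol.map Sum.inl ++ ℬ.Ol.map Sum.inr

end OMDP

end SD

namespace SD

/-- The `L∞`-error `gap_∞(L,U)` between two families of subsets of `ℝ^ι`:
the sup over the family index and over points of the larger sets of the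
distance (in the supremum norm, as an extended real) to the smaller sets. -/
noncomputable def gapInf {κ ι : Type} (L U : κ → Set (ι → ℝ)) : ℝ≥0∞ :=
  ⨆ k : κ, ⨆ p ∈ U k, ⨅ q ∈ L k, ⨆ i : ι, edist (p i) (q i)

end SD

namespace SD

namespace MDP

variable {S A : Type}

theorem enabled_of_prob_ne_zero {M : MDP S A} {s t : S} {a : A} (h : M.prob s a t ≠ 0) :
    M.enabled s a := by
  intro h0
  simp [prob, h0] at h

theorem prob_eq_zero_of_terminal {M : MDP S A} {s : S} (h : M.terminal s) (a : A) (t : S) :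
    M.prob s a t = 0 := by
  simp [prob, h a]

variable [Fintype A]

/-- Every MDP has a scheduler. -/
theorem exists_isSched (M : MDP S A) : ∃ σ : Sched S A, M.IsSched σ := by
  refine ⟨fun π a => if h : ∃ b, M.enabled π.last b then (if a = h.choose then 1 else 0) else 0,
    fun π _ => ⟨fun a => ?_, fun a ha => ?_, fun hterm => ?_⟩⟩
  · dsimp only
    split_ifs <;> norm_num
  · dsimp only at ha
    split_ifs at ha with h h'
    · exact h' ▸ h.choose_spec
    · exact absurd rfl ha
    · exact absurd rfl ha
  · have h : ∃ b, M.enabled π.last b := by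
      simpa [terminal, enabled] using hterm
    simp [h]

/-- A distribution over the actions enabled in `s` is the first choice of some scheduler. -/
theorem exists_isSched_of_dist (M : MDP S A) (s : S) (w : A → ℝ) (hw0 : ∀ a, 0 ≤ w a)
    (hwe : ∀ a, w a ≠ 0 → M.enabled s a) (hw1 : ∑ a, w a = 1) :
    ∃ σ : Sched S A, M.IsSched σ ∧ σ ⟨s, []⟩ = w := by
  obtain ⟨σ, hσ⟩ := M.exists_isSched
  refine ⟨Function.update σ ⟨s, []⟩ w, fun π hπ => ?_, Function.update_self ..⟩
  by_cases h : π = ⟨s, []⟩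
  · subst h
    rw [Function.update_self]
    exact ⟨hw0, hwe, fun _ => hw1⟩
  · rw [Function.update_of_ne h]
    exact hσ π hπ

variable [Fintype S]

theorem reachN_of_last_mem (M : MDP S A) (σ : Sched S A) {T : Set S} (n : ℕ)
    {π : FinPath S A} (h : π.last ∈ T) : M.reachN σ T n π = 1 := by
  cases n <;> simp [reachN, h]

theorem reachN_of_terminal (M : MDP S A) (σ : Sched S A) {T : Set S} (n : ℕ)
    {π : FinPath S A} (h : π.last ∉ T) (ht : M.terminal π.last) : M.reachN σ T n π = 0 := by
  cases n <;> simp [reachN, h, prob_eq_zero_of_terminal ht]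

/-- If every successor of `s ≠ t` is terminal, then reaching `t` is decided by the first step. -/
theorem Pr_singleton_of_succ_terminal (M : MDP S A) {σ : Sched S A} (hσ : M.IsSched σ)
    {s t : S} (hst : s ≠ t) (hprob : ∀ a, 0 ≤ M.prob s a t)
    (hsucc : ∀ a s', M.prob s a s' ≠ 0 → M.terminal s') :
    M.Pr σ s {t} = ∑ a, σ ⟨s, []⟩ a * M.prob s a t := by
  have hlast : (⟨s, []⟩ : FinPath S A).last = s := rfl
  have hsnoc : ∀ a s', ((⟨s, []⟩ : FinPath S A).snoc a s').last = s' := fun a s' => by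
    simp [FinPath.snoc, FinPath.last]
  have h0 : M.reachN σ {t} 0 ⟨s, []⟩ = 0 := by simp [reachN, hlast, hst]
  have h1 : ∀ n, M.reachN σ {t} (n + 1) ⟨s, []⟩ = ∑ a, σ ⟨s, []⟩ a * M.prob s a t := by
    intro n
    rw [reachN, hlast, if_neg (by simpa using hst)]
    refine Finset.sum_congr rfl fun a _ => ?_
    congr 1
    rw [Finset.sum_eq_single t]
    · rw [reachN_of_last_mem _ _ _ (by simp [hsnoc]), mul_one]
    · intro s' _ hs'
      by_cases hp : M.prob s a s' = 0
      · rw [hp, zero_mul]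
      · rw [reachN_of_terminal _ _ _ (by simpa [hsnoc] using hs')
          (by rw [hsnoc]; exact hsucc a s' hp), mul_zero]
    · simp
  have hle : ∀ n, M.reachN σ {t} n ⟨s, []⟩ ≤ ∑ a, σ ⟨s, []⟩ a * M.prob s a t := by
    intro n
    cases n with
    | zero =>
      rw [h0]
      exact Finset.sum_nonneg fun a _ =>
        mul_nonneg ((hσ ⟨s, []⟩ trivial).1 a) (hprob a)
    | succ n => exact (h1 n).le
  refine le_antisymm (ciSup_le hle) ?_
  rw [← h1 0]
  exact le_ciSup (f := fun n => M.reachN σ {t} n ⟨s, []⟩) ⟨_, by rintro _ ⟨n, rfl⟩; exact hle n⟩ 1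

end MDP

namespace OMDP

variable {S A : Type}

theorem achievable_nonempty [Fintype S] [Fintype A] (𝒜 : OMDP S A) (s : S) : (𝒜.achievable s).Nonempty := by
  obtain ⟨σ, hσ⟩ := 𝒜.M.exists_isSched
  exact ⟨_, σ, hσ, le_rfl⟩

theorem WF.not_mem_exit [Fintype S] {𝒜 : OMDP S A} (h : 𝒜.WF) {s : S} (hs : s ∈ 𝒜.entr) : s ∉ 𝒜.exit := by
  have h' := h.2.1
  rw [List.append_assoc, List.nodup_append] at h'
  exact fun he => h'.2.2 s hs s he rfl

/-- The convex hull of `B k` consists of the expectations of the distributions over the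
actions of the shortcut that are enabled in `k`. -/
theorem mem_convexHull_iff_exists_dist [Fintype S] (𝒜 : OMDP S A)
    (B : 𝒜.EntrIdx → Finset (𝒜.ExitIdx → ℝ))
    (k : 𝒜.EntrIdx) (q : 𝒜.ExitIdx → ℝ) :
    q ∈ convexHull ℝ (B k : Set (𝒜.ExitIdx → ℝ)) ↔
      ∃ w : ShortAct 𝒜 B → ℝ, (∀ a, 0 ≤ w a) ∧ (∀ a, w a ≠ 0 → a.1 ∈ B k) ∧
        ∑ a, w a = 1 ∧ ∑ a, w a • a.1 = q := by
  constructor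
  · intro h
    obtain ⟨w, hw0, hw1, hwq⟩ := Finset.mem_convexHull'.1 h
    have key : ∀ {X : Type} [AddCommMonoid X] (f : (𝒜.ExitIdx → ℝ) → X),
        ∑ a : ShortAct 𝒜 B, (if a.1 ∈ B k then f a.1 else 0) = ∑ y ∈ B k, f y := by
      intro X _ f
      rw [← Finset.sum_filter]
      refine Finset.sum_bij (fun a _ => a.1) (by simp) (fun a _ b _ => Subtype.ext) ?_ (by simp)
      exact fun y hy => ⟨⟨y, k, hy⟩, by simpa using hy, rfl⟩
    refine ⟨fun a => if a.1 ∈ B k then w a.1 else 0, fun a => ?_, fun a ha => ?_, ?_, ?_⟩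
    · dsimp only
      split_ifs with ha
      exacts [hw0 _ ha, le_rfl]
    · by_contra hn
      simp [hn] at ha
    · rw [key w, hw1]
    · simp only [ite_smul, zero_smul]
      rw [key fun y => w y • y, hwq]
  · rintro ⟨w, hw0, hwB, hw1, rfl⟩
    have hsum : ∀ {X : Type} [AddCommMonoid X] [Module ℝ X] (f : ShortAct 𝒜 B → X),
        ∑ a with w a ≠ 0, w a • f a = ∑ a, w a • f a := by
      intro X _ _ f
      rw [Finset.sum_filter]
      refine Finset.sum_congr rfl fun a _ => ?_
      split_ifs with h
      · rfl
      · rw [not_not.1 h, zero_smul]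
    rw [← hsum]
    refine (convex_convexHull ℝ _).sum_mem (fun a _ => hw0 a) ?_ fun a ha =>
      subset_convexHull ℝ _ (hwB a (by simpa using ha))
    have := hsum fun _ => (1 : ℝ)
    simpa [hw1] using this

section shortcut

variable (𝒜 : OMDP S A) (B : 𝒜.EntrIdx → Finset (𝒜.ExitIdx → ℝ))

theorem shortcut_enabled_iff (k : 𝒜.EntrIdx) (a : ShortAct 𝒜 B) :
    (𝒜.shortcut B).M.enabled (some k.1) a ↔ a.1 ∈ B k := by
  simp [MDP.enabled, shortcut, k.2]

theorem shortcut_terminal_none : (𝒜.shortcut B).M.terminal none := fun _ => rfl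

theorem shortcut_terminal_some {s : S} (hs : s ∉ 𝒜.entr) :
    (𝒜.shortcut B).M.terminal (some s) := fun a => by
  simp [shortcut, hs]

theorem shortcut_exit : (𝒜.shortcut B).exit = 𝒜.exit.map some := by
  simp [shortcut, exit]

theorem shortcut_prob_some (k : 𝒜.EntrIdx) (a : ShortAct 𝒜 B) (ha : a.1 ∈ B k) (s : S) :
    (𝒜.shortcut B).M.prob (some k.1) a (some s) =
      ∑ j : 𝒜.ExitIdx, if j.1 = s then a.1 j else 0 := by
  simp [MDP.prob, shortcut, k.2, ha]

theorem shortcut_prob_exit (k : 𝒜.EntrIdx) (a : ShortAct 𝒜 B) (ha : a.1 ∈ B k)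
    (j : 𝒜.ExitIdx) : (𝒜.shortcut B).M.prob (some k.1) a (some j.1) = a.1 j := by
  rw [shortcut_prob_some 𝒜 B k a ha]
  simp [← Subtype.ext_iff]

variable {𝒜 B}

theorem shortcut_succ_terminal [Fintype S] (hWF : 𝒜.WF) (k : 𝒜.EntrIdx) (a : ShortAct 𝒜 B) (t : Option S)
    (h : (𝒜.shortcut B).M.prob (some k.1) a t ≠ 0) : (𝒜.shortcut B).M.terminal t := by
  have ha := (𝒜.shortcut_enabled_iff B k a).1 (MDP.enabled_of_prob_ne_zero h)
  cases t with
  | none => exact 𝒜.shortcut_terminal_none B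
  | some s =>
    refine 𝒜.shortcut_terminal_some B fun hs => h ?_
    rw [shortcut_prob_some 𝒜 B k a ha]
    refine Finset.sum_eq_zero fun j _ => if_neg ?_
    rintro rfl
    exact hWF.not_mem_exit hs j.2

end shortcut

/-- `𝒳` contains the shortcut oMDP `D(B)` as a union of connected components, embedded by `e`
on states and by `c` on actions. -/
structure ShortcutEmbedding {T C : Type} (𝒜 : OMDP S A)
    (B : 𝒜.EntrIdx → Finset (𝒜.ExitIdx → ℝ)) (𝒳 : OMDP T C) (e : Option S → T)
    (c : ShortAct 𝒜 B → C) : Prop where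
  e_inj : Function.Injective e
  c_inj : Function.Injective c
  enabled_iff : ∀ t a, 𝒳.M.enabled (e t) a ↔ ∃ b, c b = a ∧ (𝒜.shortcut B).M.enabled t b
  prob_eq : ∀ t a t', 𝒳.M.prob (e t) (c a) (e t') = (𝒜.shortcut B).M.prob t a t'
  prob_eq_zero : ∀ t a t', t' ∉ Set.range e → 𝒳.M.prob (e t) a t' = 0
  mem_exit_iff : ∀ t, e t ∈ 𝒳.exit ↔ t ∈ (𝒜.shortcut B).exit

namespace ShortcutEmbedding

variable {T C : Type} {𝒜 : OMDP S A}
    {B : 𝒜.EntrIdx → Finset (𝒜.ExitIdx → ℝ)} {𝒳 : OMDP T C} {e : Option S → T}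
    {c : ShortAct 𝒜 B → C}

theorem exit_mem (h : ShortcutEmbedding 𝒜 B 𝒳 e c) (j : 𝒜.ExitIdx) : e (some j.1) ∈ 𝒳.exit := by
  rw [h.mem_exit_iff, shortcut_exit]
  exact List.mem_map_of_mem j.2

theorem exists_exit_of_mem_range (h : ShortcutEmbedding 𝒜 B 𝒳 e c) {t : T} (ht : t ∈ 𝒳.exit)
    (hr : t ∈ Set.range e) : ∃ j : 𝒜.ExitIdx, e (some j.1) = t := by
  obtain ⟨x, rfl⟩ := hr
  rw [h.mem_exit_iff, shortcut_exit, List.mem_map] at ht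
  obtain ⟨s, hs, rfl⟩ := ht
  exact ⟨⟨s, hs⟩, rfl⟩

theorem terminal (h : ShortcutEmbedding 𝒜 B 𝒳 e c) {t : Option S}
    (ht : (𝒜.shortcut B).M.terminal t) : 𝒳.M.terminal (e t) := by
  intro a
  by_contra hn
  obtain ⟨b, -, hb⟩ := (h.enabled_iff t a).1 hn
  exact hb (ht b)

variable [Fintype S]

theorem prob_nonneg (h : ShortcutEmbedding 𝒜 B 𝒳 e c) (hB : ∀ k, ∀ p ∈ B k, Subdist p)
    (k : 𝒜.EntrIdx) (j : 𝒳.ExitIdx) (a : C) : 0 ≤ 𝒳.M.prob (e (some k.1)) a j.1 := by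
  by_cases hp : 𝒳.M.prob (e (some k.1)) a j.1 = 0
  · exact hp.ge
  · have hr : j.1 ∈ Set.range e := by
      by_contra hr
      exact hp (h.prob_eq_zero _ _ _ hr)
    obtain ⟨i, hi⟩ := h.exists_exit_of_mem_range j.2 hr
    obtain ⟨b, rfl, hb⟩ := (h.enabled_iff _ a).1 (MDP.enabled_of_prob_ne_zero hp)
    rw [shortcut_enabled_iff] at hb
    rw [← hi, h.prob_eq, shortcut_prob_exit 𝒜 B k b hb]
    exact (hB k _ hb).1 i

variable [Fintype C]

theorem sum_mul_prob (h : ShortcutEmbedding 𝒜 B 𝒳 e c) (k : 𝒜.EntrIdx) {w : C → ℝ}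
    (j : 𝒜.ExitIdx) :
    ∑ a, w a * 𝒳.M.prob (e (some k.1)) a (e (some j.1)) =
      ∑ b, w (c b) * (𝒜.shortcut B).M.prob (some k.1) b (some j.1) := by
  simp only [← h.prob_eq]
  symm
  refine Finset.sum_of_injOn c h.c_inj.injOn (by simp) (fun a _ ha => ?_) fun _ _ => rfl
  by_cases hp : 𝒳.M.prob (e (some k.1)) a (e (some j.1)) = 0
  · rw [hp, mul_zero]
  · obtain ⟨b, rfl, -⟩ := (h.enabled_iff _ a).1 (MDP.enabled_of_prob_ne_zero hp)
    simp at ha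

theorem sum_comp_eq (h : ShortcutEmbedding 𝒜 B 𝒳 e c) (k : 𝒜.EntrIdx) {w : C → ℝ}
    (hw : ∀ a, w a ≠ 0 → 𝒳.M.enabled (e (some k.1)) a) : ∑ b, w (c b) = ∑ a, w a := by
  refine Finset.sum_of_injOn c h.c_inj.injOn (by simp) (fun a _ ha => ?_) fun _ _ => rfl
  by_contra hp
  obtain ⟨b, rfl, -⟩ := (h.enabled_iff _ a).1 (hw a hp)
  simp at ha

variable [Fintype T]

theorem prVec_eq (h : ShortcutEmbedding 𝒜 B 𝒳 e c) (hWF : 𝒜.WF)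
    (hB : ∀ k, ∀ p ∈ B k, Subdist p) {σ : Sched T C} (hσ : 𝒳.M.IsSched σ) (k : 𝒜.EntrIdx)
    (j : 𝒳.ExitIdx) :
    𝒳.prVec σ (e (some k.1)) j =
      ∑ a, σ ⟨e (some k.1), []⟩ a * 𝒳.M.prob (e (some k.1)) a j.1 := by
  refine 𝒳.M.Pr_singleton_of_succ_terminal hσ ?_ (h.prob_nonneg hB k j) fun a t ht => ?_
  · intro he
    obtain ⟨i, hi⟩ := h.exists_exit_of_mem_range j.2 ⟨_, he⟩
    have : i.1 = k.1 := Option.some_injective _ (h.e_inj (hi.trans he.symm))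
    exact hWF.not_mem_exit k.2 (this ▸ i.2)
  · have hr : t ∈ Set.range e := by
      by_contra hr
      exact ht (h.prob_eq_zero _ _ _ hr)
    obtain ⟨t, rfl⟩ := hr
    obtain ⟨b, rfl, -⟩ := (h.enabled_iff _ a).1 (MDP.enabled_of_prob_ne_zero ht)
    rw [h.prob_eq] at ht
    exact h.terminal (shortcut_succ_terminal hWF k b t ht)

/-- The points achievable from an entrance of an embedded shortcut are those whose restriction
to the exits of the shortcut lies in the downward convex closure, and which are nonpositive on
the remaining exits. -/
theorem mem_achievable_iff (h : ShortcutEmbedding 𝒜 B 𝒳 e c) (hWF : 𝒜.WF)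
    (hB : ∀ k, ∀ p ∈ B k, Subdist p) (k : 𝒜.EntrIdx) (hk : (B k).Nonempty)
    (p : 𝒳.ExitIdx → ℝ) :
    p ∈ 𝒳.achievable (e (some k.1)) ↔
      (fun j : 𝒜.ExitIdx => p ⟨e (some j.1), h.exit_mem j⟩) ∈
          dwConv (B k : Set (𝒜.ExitIdx → ℝ)) ∧
        ∀ j : 𝒳.ExitIdx, j.1 ∉ Set.range e → p j ≤ 0 := by
  have hval : ∀ (v : ShortAct 𝒜 B → ℝ), (∀ b, v b ≠ 0 → b.1 ∈ B k) → ∀ j : 𝒜.ExitIdx,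
      ∑ b, v b * (𝒜.shortcut B).M.prob (some k.1) b (some j.1) = (∑ b, v b • b.1) j := by
    intro v hv j
    rw [Finset.sum_apply]
    refine Finset.sum_congr rfl fun b _ => ?_
    by_cases hb : v b = 0
    · simp [hb]
    · rw [shortcut_prob_exit 𝒜 B k b (hv b hb), Pi.smul_apply, smul_eq_mul]
  constructor
  · rintro ⟨σ, hσ, hp⟩
    obtain ⟨hσ0, hσe, hσ1⟩ := hσ ⟨e (some k.1), []⟩ trivial
    have hnt : ¬ 𝒳.M.terminal (e (some k.1)) := by
      intro ht
      obtain ⟨b, hb⟩ := hk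
      refine (h.enabled_iff (some k.1) (c ⟨b, k, hb⟩)).2 ⟨_, rfl, ?_⟩ (ht _)
      rwa [shortcut_enabled_iff]
    have hv : ∀ b, σ ⟨e (some k.1), []⟩ (c b) ≠ 0 → b.1 ∈ B k := fun b hb => by
      obtain ⟨b', hb', hen⟩ := (h.enabled_iff (some k.1) (c b)).1 (hσe _ hb)
      rw [h.c_inj hb', shortcut_enabled_iff] at hen
      exact hen
    refine ⟨⟨_, (mem_convexHull_iff_exists_dist 𝒜 B k _).2
      ⟨fun b => σ ⟨e (some k.1), []⟩ (c b), fun b => hσ0 _, hv, ?_, rfl⟩, fun j => ?_⟩,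
      fun j hj => ?_⟩
    · exact (h.sum_comp_eq k hσe).trans (hσ1 hnt)
    · rw [← hval _ hv, ← h.sum_mul_prob k]
      exact (hp _).trans_eq (h.prVec_eq hWF hB hσ k ⟨e (some j.1), h.exit_mem j⟩)
    · refine (hp j).trans ?_
      rw [h.prVec_eq hWF hB hσ]
      simp [h.prob_eq_zero _ _ _ hj]
  · rintro ⟨⟨q, hq, hpq⟩, hp0⟩
    obtain ⟨v, hv0, hvB, hv1, rfl⟩ := (mem_convexHull_iff_exists_dist 𝒜 B k q).1 hq
    have hvc : ∀ b, Function.extend c v 0 (c b) = v b := fun b => h.c_inj.extend_apply v (0 : C → ℝ) b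
    have hwe : ∀ a, Function.extend c v 0 a ≠ 0 → 𝒳.M.enabled (e (some k.1)) a := fun a ha => by
      by_cases hr : ∃ b, c b = a
      · obtain ⟨b, rfl⟩ := hr
        rw [hvc] at ha
        exact (h.enabled_iff _ _).2 ⟨b, rfl, (𝒜.shortcut_enabled_iff B k b).2 (hvB b ha)⟩
      · exact absurd (Function.extend_apply' v (0 : C → ℝ) a hr) ha
    obtain ⟨σ, hσ, hσw⟩ := 𝒳.M.exists_isSched_of_dist (e (some k.1)) (Function.extend c v 0)
      (fun a => by
        by_cases hr : ∃ b, c b = a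
        · obtain ⟨b, rfl⟩ := hr
          rw [hvc]
          exact hv0 b
        · exact (Function.extend_apply' v (0 : C → ℝ) a hr).ge)
      hwe (by rw [← h.sum_comp_eq k hwe]; simpa only [hvc] using hv1)
    refine ⟨σ, hσ, fun j => ?_⟩
    rw [h.prVec_eq hWF hB hσ, hσw]
    by_cases hr : j.1 ∈ Set.range e
    · obtain ⟨i, hi⟩ := h.exists_exit_of_mem_range j.2 hr
      obtain ⟨j, hj⟩ := j
      subst hi
      rw [h.sum_mul_prob k]
      simp only [hvc]
      rw [hval v hvB]
      exact hpq i
    · simpa [h.prob_eq_zero _ _ _ hr] using hp0 j hr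

/-- The error at an entrance does not grow under embedding the two shortcuts. -/
theorem iInf_edist_le {C' : Type} [Fintype C'] {BL : 𝒜.EntrIdx → Finset (𝒜.ExitIdx → ℝ)}
    {𝒴 : OMDP T C'} {c' : ShortAct 𝒜 BL → C'} (hU : ShortcutEmbedding 𝒜 B 𝒳 e c)
    (hL : ShortcutEmbedding 𝒜 BL 𝒴 e c') (hexit : ∀ t, t ∈ 𝒴.exit ↔ t ∈ 𝒳.exit) (hWF : 𝒜.WF)
    (hB : ∀ k, ∀ p ∈ B k, Subdist p) (hBL : ∀ k, ∀ p ∈ BL k, Subdist p)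
    (k : 𝒜.EntrIdx) (hk : (B k).Nonempty) {p : 𝒳.ExitIdx → ℝ}
    (hp : p ∈ 𝒳.achievable (e (some k.1))) :
    (⨅ q ∈ 𝒴.achievable (e (some k.1)),
        ⨆ j : 𝒳.ExitIdx, edist (p j) (q ⟨j.1, (hexit _).2 j.2⟩)) ≤
      gapInf (fun k => dwConv (BL k : Set (𝒜.ExitIdx → ℝ)))
        (fun k => dwConv (B k : Set (𝒜.ExitIdx → ℝ))) := by
  obtain ⟨hpB, hp0⟩ := (hU.mem_achievable_iff hWF hB k hk p).1 hp
  refine le_trans ?_ (le_iSup_of_le k (le_iSup₂_of_le _ hpB le_rfl))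
  refine le_iInf₂ fun q hq => ?_
  have hkL : (BL k).Nonempty := by
    obtain ⟨q', hq', -⟩ := hq
    exact_mod_cast convexHull_nonempty_iff.1 ⟨q', hq'⟩
  have hinj : Function.Injective fun j : 𝒜.ExitIdx => e (some j.1) := fun i j hij =>
    Subtype.ext (Option.some_injective _ (hU.e_inj hij))
  let r : T → ℝ := Function.extend (fun j : 𝒜.ExitIdx => e (some j.1)) q
    fun t => if ht : t ∈ 𝒳.exit then p ⟨t, ht⟩ else 0
  have hr : ∀ j : 𝒜.ExitIdx, r (e (some j.1)) = q j := fun j => hinj.extend_apply q _ j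
  have hr' : ∀ j : 𝒳.ExitIdx, j.1 ∉ Set.range e → r j.1 = p j := fun j hj => by
    refine (Function.extend_apply' _ _ _ ?_).trans (dif_pos j.2)
    rintro ⟨i, hi⟩
    exact hj ⟨_, hi⟩
  refine iInf₂_le_of_le (fun j => r j.1) ((hL.mem_achievable_iff hWF hBL k hkL _).2 ⟨?_, ?_⟩) ?_
  · simpa only [hr] using hq
  · intro j hj
    exact (hr' ⟨j.1, (hexit _).1 j.2⟩ hj).trans_le (hp0 _ hj)
  · refine iSup_le fun j => ?_
    by_cases hj : j.1 ∈ Set.range e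
    · obtain ⟨i, hi⟩ := hU.exists_exit_of_mem_range j.2 hj
      obtain ⟨j, hj⟩ := j
      subst hi
      dsimp only
      rw [hr]
      exact le_iSup (fun i : 𝒜.ExitIdx => edist (p ⟨e (some i.1), hU.exit_mem i⟩) (q i)) i
    · dsimp only
      rw [hr' j hj, edist_self]
      exact zero_le

end ShortcutEmbedding

section sum

variable {S₁ A₁ S₂ A₂ : Type}

theorem mem_sumComp_exit (𝒜 : OMDP S₁ A₁) (ℬ : OMDP S₂ A₂) (t : S₁ ⊕ S₂) :
    t ∈ (𝒜.sumComp ℬ).exit ↔ Sum.elim (· ∈ 𝒜.exit) (· ∈ ℬ.exit) t := by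
  cases t <;> simp [sumComp, exit]

theorem mem_sumComp_entr (𝒜 : OMDP S₁ A₁) (ℬ : OMDP S₂ A₂) (t : S₁ ⊕ S₂) :
    t ∈ (𝒜.sumComp ℬ).entr ↔ Sum.elim (· ∈ 𝒜.entr) (· ∈ ℬ.entr) t := by
  cases t <;> simp [sumComp, entr]

variable (𝒜 : OMDP S₁ A₁) (ℬ : OMDP S₂ A₂)
  (BA : 𝒜.EntrIdx → Finset (𝒜.ExitIdx → ℝ)) (BB : ℬ.EntrIdx → Finset (ℬ.ExitIdx → ℝ))

theorem shortcutEmbedding_inl : ShortcutEmbedding 𝒜 BA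
    ((𝒜.shortcut BA).sumComp (ℬ.shortcut BB)) Sum.inl Sum.inl where
  e_inj := Sum.inl_injective
  c_inj := Sum.inl_injective
  enabled_iff t a := by
    cases a <;> simp [MDP.enabled, sumComp]
  prob_eq t a t' := by
    simp only [MDP.prob, sumComp]
    cases (𝒜.shortcut BA).M.P t a <;> rfl
  prob_eq_zero t a t' ht' := by
    obtain t' | t' := t'
    · exact absurd ⟨_, rfl⟩ ht'
    · obtain a | a := a
      · simp only [MDP.prob, sumComp]
        cases (𝒜.shortcut BA).M.P t a <;> rfl
      · rfl
  mem_exit_iff t := mem_sumComp_exit _ _ _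

theorem shortcutEmbedding_inr : ShortcutEmbedding ℬ BB
    ((𝒜.shortcut BA).sumComp (ℬ.shortcut BB)) Sum.inr Sum.inr where
  e_inj := Sum.inr_injective
  c_inj := Sum.inr_injective
  enabled_iff t a := by
    cases a <;> simp [MDP.enabled, sumComp]
  prob_eq t a t' := by
    simp only [MDP.prob, sumComp]
    cases (ℬ.shortcut BB).M.P t a <;> rfl
  prob_eq_zero t a t' ht' := by
    obtain t' | t' := t'
    · obtain a | a := a
      · rfl
      · simp only [MDP.prob, sumComp]
        cases (ℬ.shortcut BB).M.P t a <;> rfl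
    · exact absurd ⟨_, rfl⟩ ht'
  mem_exit_iff t := mem_sumComp_exit _ _ _

end sum

theorem nonempty_of_achievable_subset [Fintype S] [Fintype A] {𝒜 : OMDP S A} {s : S} {V : Finset (𝒜.ExitIdx → ℝ)}
    (h : 𝒜.achievable s ⊆ dwConv (V : Set (𝒜.ExitIdx → ℝ))) : V.Nonempty := by
  obtain ⟨p, hp⟩ := 𝒜.achievable_nonempty s
  obtain ⟨q, hq, -⟩ := h hp
  exact_mod_cast convexHull_nonempty_iff.1 ⟨q, hq⟩

end OMDP

end SD

open SD in
/-- Let `𝒜`, `ℬ` be open MDPs and `(L^𝒜,U^𝒜)`, `(L^ℬ,U^ℬ)` sound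
approximations of `𝒜` and `ℬ` (given by vertex families of subdistributions).
Define `L^{𝒜⊕ℬ} := (A^{D(L^𝒜)⊕D(L^ℬ)}(i))_i` and
`U^{𝒜⊕ℬ} := (A^{D(U^𝒜)⊕D(U^ℬ)}(i))_i`, indexed by the entrances of `𝒜 ⊕ ℬ`.
Then `gap_∞(L^{𝒜⊕ℬ}, U^{𝒜⊕ℬ}) ≤ max(gap_∞(L^𝒜,U^𝒜), gap_∞(L^ℬ,U^ℬ))`. -/
theorem statement_12 {S₁ A₁ S₂ A₂ : Type}
    [Fintype S₁] [Fintype A₁] [Fintype S₂] [Fintype A₂]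
    (𝒜 : OMDP S₁ A₁) (ℬ : OMDP S₂ A₂) (hWFA : 𝒜.WF) (hWFB : ℬ.WF)
    (VLA VUA : 𝒜.EntrIdx → Finset (𝒜.ExitIdx → ℝ))
    (VLB VUB : ℬ.EntrIdx → Finset (ℬ.ExitIdx → ℝ))
    (hVLA : ∀ k, ∀ p ∈ VLA k, Subdist p) (hVUA : ∀ k, ∀ p ∈ VUA k, Subdist p)
    (hVLB : ∀ k, ∀ p ∈ VLB k, Subdist p) (hVUB : ∀ k, ∀ p ∈ VUB k, Subdist p)
    (hsoundA : ∀ k : 𝒜.EntrIdx,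
      dwConv ((VLA k : Finset (𝒜.ExitIdx → ℝ)) : Set (𝒜.ExitIdx → ℝ)) ⊆ 𝒜.achievable k.1 ∧
        𝒜.achievable k.1 ⊆ dwConv ((VUA k : Finset (𝒜.ExitIdx → ℝ)) : Set (𝒜.ExitIdx → ℝ)))
    (hsoundB : ∀ k : ℬ.EntrIdx,
      dwConv ((VLB k : Finset (ℬ.ExitIdx → ℝ)) : Set (ℬ.ExitIdx → ℝ)) ⊆ ℬ.achievable k.1 ∧
        ℬ.achievable k.1 ⊆ dwConv ((VUB k : Finset (ℬ.ExitIdx → ℝ)) : Set (ℬ.ExitIdx → ℝ))) :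
    gapInf
        (fun k : (𝒜.sumComp ℬ).EntrIdx =>
          ((𝒜.shortcut VLA).sumComp (ℬ.shortcut VLB)).achievable (Sum.map some some k.1))
        (fun k : (𝒜.sumComp ℬ).EntrIdx =>
          ((𝒜.shortcut VUA).sumComp (ℬ.shortcut VUB)).achievable (Sum.map some some k.1)) ≤
      max
        (gapInf
          (fun k : 𝒜.EntrIdx => dwConv ((VLA k : Finset (𝒜.ExitIdx → ℝ)) : Set (𝒜.ExitIdx → ℝ)))
          (fun k : 𝒜.EntrIdx => dwConv ((VUA k : Finset (𝒜.ExitIdx → ℝ)) : Set (𝒜.ExitIdx → ℝ))))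
        (gapInf
          (fun k : ℬ.EntrIdx => dwConv ((VLB k : Finset (ℬ.ExitIdx → ℝ)) : Set (ℬ.ExitIdx → ℝ)))
          (fun k : ℬ.EntrIdx => dwConv ((VUB k : Finset (ℬ.ExitIdx → ℝ)) : Set (ℬ.ExitIdx → ℝ)))) := by
  refine iSup_le fun ⟨k, hk⟩ => iSup₂_le fun p hp => ?_
  rw [OMDP.mem_sumComp_entr] at hk
  obtain s | s := k
  · exact le_max_of_le_left <| (𝒜.shortcutEmbedding_inl ℬ VUA VUB).iInf_edist_le
      (𝒜.shortcutEmbedding_inl ℬ VLA VLB) (fun _ => Iff.rfl) hWFA hVUA hVLA ⟨s, hk⟩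
      (OMDP.nonempty_of_achievable_subset (hsoundA ⟨s, hk⟩).2) hp
  · exact le_max_of_le_right <| (𝒜.shortcutEmbedding_inr ℬ VUA VUB).iInf_edist_le
      (𝒜.shortcutEmbedding_inr ℬ VLA VLB) (fun _ => Iff.rfl) hWFB hVUB hVLB ⟨s, hk⟩
      (OMDP.nonempty_of_achievable_subset (hsoundB ⟨s, hk⟩).2) hp
end

section
/- Let 𝒜, ℬ be rightward open MDPs (no leftward open ends) such that 𝒜⨟ℬ is well-defined, let (L^𝒜,U^𝒜), (L^ℬ,U^ℬ) be sound approximations of 𝒜 and ℬ, and let (L^{𝒜⨟ℬ}, U_X) be a sound approximation of D(L^𝒜)⨟D(L^ℬ) and (L_X, U^{𝒜⨟ℬ}) a sound approximation of D(U^𝒜)⨟D(U^ℬ). Then gap_∞(L^{𝒜⨟ℬ}, U^{𝒜⨟ℬ}) ≤ |O^𝒜| · gap_∞(L^𝒜, U^𝒜) + gap_∞(L^ℬ, U^ℬ) + gap_∞(L^{𝒜⨟ℬ}, U_X) + gap_∞(L_X, U^{𝒜⨟ℬ}), where |O^𝒜| is the number of exits of 𝒜. -/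
open scoped Classical ENNReal

namespace SD

namespace OMDP

variable {S₁ A₁ S₂ A₂ : Type}

/-- The sequential composition `𝒜 ⨟ ℬ` of type-matching open MDPs: the disjoint
union of the two oMDPs in which the `i`-th rightward exit of `𝒜` moves with
probability 1 to the `i`-th rightward entrance of `ℬ` and the `i`-th leftward
exit of `ℬ` moves with probability 1 to the `i`-th leftward entrance of `𝒜`;
its entrances are `(I_r^𝒜, I_l^ℬ)` and its exits are `(O_r^ℬ, O_l^𝒜)`. -/
noncomputable def seqComp (𝒜 : OMDP S₁ A₁) (ℬ : OMDP S₂ A₂)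
    (h₁ : 𝒜.Or.length = ℬ.Ir.length) (h₂ : ℬ.Ol.length = 𝒜.Il.length) :
    OMDP (S₁ ⊕ S₂) (A₁ ⊕ A₂) where
  M := ⟨fun t a =>
    match t with
    | Sum.inl s =>
        if h : ∃ k : Fin 𝒜.Or.length, 𝒜.Or.get k = s then
          some fun t' => if t' = Sum.inr (ℬ.Ir.get (Fin.cast h₁ h.choose)) then 1 else 0
        else
          match a with
          | Sum.inl a => (𝒜.M.P s a).map fun d => Sum.elim d fun _ => 0
          | Sum.inr _ => none
    | Sum.inr s =>
        if h : ∃ k : Fin ℬ.Ol.length, ℬ.Ol.get k = s then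
          some fun t' => if t' = Sum.inl (𝒜.Il.get (Fin.cast h₂ h.choose)) then 1 else 0
        else
          match a with
          | Sum.inr a => (ℬ.M.P s a).map fun d => Sum.elim (fun _ => 0) d
          | Sum.inl _ => none⟩
  Ir := 𝒜.Ir.map Sum.inl
  Il := ℬ.Il.map Sum.inr
  Or := ℬ.Or.map Sum.inr
  Ol := 𝒜.Ol.map Sum.inl

/-- The sequential composition `σ₁ ⨟ σ₂` of memoryless schedulers on `𝒜` and `ℬ`:
it behaves like `σ₁` on the states of `𝒜` and like `σ₂` on the states of `ℬ`
(on the connecting exits, where all actions induce the same probability-1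
transition, it plays uniformly). -/
noncomputable def schedSeqComp [Fintype A₁] [Fintype A₂] (𝒜 : OMDP S₁ A₁) (ℬ : OMDP S₂ A₂)
    (σ₁ : Sched S₁ A₁) (σ₂ : Sched S₂ A₂) : Sched (S₁ ⊕ S₂) (A₁ ⊕ A₂) := fun π a =>
  match π.last, a with
  | Sum.inl s, a =>
      if s ∈ 𝒜.Or then ((Fintype.card (A₁ ⊕ A₂) : ℝ))⁻¹
      else
        match a with
        | Sum.inl a => σ₁ ⟨s, []⟩ a
        | Sum.inr _ => 0
  | Sum.inr s, a =>
      if s ∈ ℬ.Ol then ((Fintype.card (A₁ ⊕ A₂) : ℝ))⁻¹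
      else
        match a with
        | Sum.inr a => σ₂ ⟨s, []⟩ a
        | Sum.inl _ => 0

/-- The restriction of a (memoryless) scheduler on `𝒜 ⨟ ℬ` to the states of `𝒜`. -/
noncomputable def restrictL [Fintype S₁] [Fintype A₁] (𝒜 : OMDP S₁ A₁)
    (τ : Sched (S₁ ⊕ S₂) (A₁ ⊕ A₂)) : Sched S₁ A₁ := fun π a =>
  if 𝒜.M.terminal π.last then 0 else τ ⟨Sum.inl π.last, []⟩ (Sum.inl a)

/-- The restriction of a (memoryless) scheduler on `𝒜 ⨟ ℬ` to the states of `ℬ`. -/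
noncomputable def restrictR [Fintype S₂] [Fintype A₂] (ℬ : OMDP S₂ A₂)
    (τ : Sched (S₁ ⊕ S₂) (A₁ ⊕ A₂)) : Sched S₂ A₂ := fun π a =>
  if ℬ.M.terminal π.last then 0 else τ ⟨Sum.inr π.last, []⟩ (Sum.inr a)

end OMDP

end SD

namespace SD

open OMDP

/-- The convex hull of a set of points, extended by `{0}` for the empty set. -/
def hullOrZero {ι : Type} (V : Set (ι → ℝ)) : Set (ι → ℝ) :=
  if V.Nonempty then convexHull ℝ V else {0}

theorem convex_hullOrZero {ι : Type} (V : Set (ι → ℝ)) : Convex ℝ (hullOrZero V) := by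
  unfold hullOrZero
  split_ifs
  · exact convex_convexHull ℝ V
  · exact convex_singleton 0

theorem hullOrZero_nonempty {ι : Type} (V : Set (ι → ℝ)) : (hullOrZero V).Nonempty := by
  unfold hullOrZero
  split_ifs with h
  · exact h.convexHull
  · exact Set.singleton_nonempty 0

theorem convex_subdist {ι : Type} [Fintype ι] : Convex ℝ {p : ι → ℝ | Subdist p} := by
  intro p hp q hq s t hs ht hst
  refine ⟨fun j => ?_, ?_⟩
  · have := hp.1 j
    have := hq.1 j
    simp only [Pi.add_apply, Pi.smul_apply, smul_eq_mul]
    positivity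
  · simp only [Pi.add_apply, Pi.smul_apply, smul_eq_mul, Finset.sum_add_distrib,
      ← Finset.mul_sum]
    have := mul_le_mul_of_nonneg_left hp.2 hs
    have := mul_le_mul_of_nonneg_left hq.2 ht
    linarith

theorem subdist_of_mem_hullOrZero {ι : Type} [Fintype ι] {V : Set (ι → ℝ)}
    (hV : ∀ p ∈ V, Subdist p) {p : ι → ℝ} (hp : p ∈ hullOrZero V) : Subdist p := by
  unfold hullOrZero at hp
  split_ifs at hp
  · exact convexHull_min (t := {p | Subdist p}) hV convex_subdist hp
  · rw [Set.mem_singleton_iff] at hp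
    subst hp
    exact ⟨fun _ => le_rfl, by simp⟩

/-- Nonnegative combinations of points of a nonempty convex set are multiples of one point. -/
theorem exists_sum_eq_mul {α ι : Type} [Fintype α] {C : Set (ι → ℝ)} (hC : Convex ℝ C)
    (hne : C.Nonempty) (w : α → ℝ) (x : α → ι → ℝ) (hw : ∀ i, 0 ≤ w i)
    (hx : ∀ i, w i ≠ 0 → x i ∈ C) :
    ∃ c ∈ C, ∀ o, ∑ i, w i * x i o = (∑ i, w i) * c o := by
  by_cases h0 : ∑ i, w i = 0
  · obtain ⟨c, hc⟩ := hne
    refine ⟨c, hc, fun o => ?_⟩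
    rw [h0, zero_mul]
    have := (Finset.sum_eq_zero_iff_of_nonneg (fun i _ => hw i)).1 h0
    exact Finset.sum_eq_zero fun i hi => by rw [this i hi, zero_mul]
  · have hpos : 0 < ∑ i, w i :=
      lt_of_le_of_ne (Finset.sum_nonneg fun i _ => hw i) (Ne.symm h0)
    obtain ⟨c₀, hc₀⟩ := hne
    refine ⟨∑ i, (w i / ∑ i, w i) • (if w i = 0 then c₀ else x i), ?_, fun o => ?_⟩
    · refine hC.sum_mem (fun i _ => div_nonneg (hw i) hpos.le) ?_ fun i _ => ?_
      · rw [← Finset.sum_div, div_self h0]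
      · split_ifs with h
        · exact hc₀
        · exact hx i h
    · rw [Finset.sum_apply, Finset.mul_sum]
      refine Finset.sum_congr rfl fun i _ => ?_
      by_cases h : w i = 0
      · simp [h]
      · simp only [h, if_false, Pi.smul_apply, smul_eq_mul]
        field_simp

theorem sum_mem_of_weights {α ι : Type} [Fintype α] {C : Set (ι → ℝ)} (hC : Convex ℝ C)
    (w : α → ℝ) (x : α → ι → ℝ) (hw : ∀ i, 0 ≤ w i) (h1 : ∑ i, w i = 1)
    (hx : ∀ i, w i ≠ 0 → x i ∈ C) : (fun o => ∑ i, w i * x i o) ∈ C := by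
  have hne : C.Nonempty := by
    by_contra h
    have : ∀ i, w i = 0 := fun i => by
      by_contra hi
      exact h ⟨_, hx i hi⟩
    simp [this] at h1
  obtain ⟨c, hc, h⟩ := exists_sum_eq_mul hC hne w x hw hx
  have : (fun o => ∑ i, w i * x i o) = c := by
    funext o
    rw [h o, h1, one_mul]
  rwa [this]

/-- Distributions over the points of `V`, whenever there are any. -/
structure ChoiceWeights {ι : Type} {Q : (ι → ℝ) → Prop} [Fintype {p : ι → ℝ // Q p}]
    (V : Set (ι → ℝ)) (w : {p : ι → ℝ // Q p} → ℝ) : Prop where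
  nonneg : ∀ p, 0 ≤ w p
  mem : ∀ p, w p ≠ 0 → p.1 ∈ V
  sum_eq : V.Nonempty → ∑ p, w p = 1

theorem ChoiceWeights.sum_mem {ι : Type} {Q : (ι → ℝ) → Prop} [Fintype {p : ι → ℝ // Q p}]
    {V : Set (ι → ℝ)} {w : {p : ι → ℝ // Q p} → ℝ} (h : ChoiceWeights V w) :
    (fun o => ∑ p, w p * p.1 o) ∈ hullOrZero V := by
  unfold hullOrZero
  split_ifs with hV
  · exact sum_mem_of_weights (convex_convexHull ℝ V) w (fun p => p.1) h.nonneg (h.sum_eq hV)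
      fun p hp => subset_convexHull ℝ V (h.mem p hp)
  · have : ∀ p, w p = 0 := fun p => by
      by_contra hp
      exact hV ⟨_, h.mem p hp⟩
    simp only [this, zero_mul, Finset.sum_const_zero]
    rfl

theorem exists_choiceWeights {ι : Type} {Q : (ι → ℝ) → Prop} [Fintype {p : ι → ℝ // Q p}]
    {V : Finset (ι → ℝ)} (hQ : ∀ p ∈ V, Q p) {a : ι → ℝ}
    (ha : a ∈ hullOrZero (V : Set (ι → ℝ))) :
    ∃ w : {p : ι → ℝ // Q p} → ℝ, ChoiceWeights (V : Set (ι → ℝ)) w ∧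
      ∀ o, ∑ p, w p * p.1 o = a o := by
  unfold hullOrZero at ha
  split_ifs at ha with hV
  · rw [Finset.mem_convexHull'] at ha
    obtain ⟨w, hw0, hw1, hwa⟩ := ha
    have key : ∀ f : (ι → ℝ) → ℝ,
        ∑ p : {p : ι → ℝ // Q p}, (if p.1 ∈ V then f p.1 else 0) = ∑ p ∈ V, f p := by
      intro f
      rw [← Finset.sum_filter]
      refine Finset.sum_bij (fun p _ => p.1) (by simp) (fun _ _ _ _ h => Subtype.ext h) ?_
        (fun _ _ => rfl)
      intro p hp
      exact ⟨⟨p, hQ p hp⟩, by simpa using hp, rfl⟩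
    refine ⟨fun p => if p.1 ∈ V then w p.1 else 0, ⟨fun p => ?_, fun p hp => ?_, fun _ => ?_⟩,
      fun o => ?_⟩
    · split_ifs with h
      · exact hw0 _ h
      · exact le_rfl
    · by_contra h
      exact hp (if_neg h)
    · rw [key, hw1]
    · simp only [ite_mul, zero_mul]
      rw [key fun p => w p * p o, ← hwa, Finset.sum_apply]
      rfl
  · rw [Set.mem_singleton_iff] at ha
    subst ha
    exact ⟨fun _ => 0, ⟨fun _ => le_rfl, fun _ h => absurd rfl h, fun h => absurd h hV⟩,
      by simp⟩

theorem exists_edist_lt_of_gapInf_lt {κ ι : Type} {L U : κ → Set (ι → ℝ)} {δ : ℝ}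
    (hδ : gapInf L U < ENNReal.ofReal δ) {k : κ} {p : ι → ℝ} (hp : p ∈ U k) :
    ∃ q ∈ L k, ∀ i, |p i - q i| < δ := by
  have h : (⨅ q ∈ L k, ⨆ i : ι, edist (p i) (q i)) < ENNReal.ofReal δ :=
    lt_of_le_of_lt (le_trans (le_iSup₂ (f := fun p (_ : p ∈ U k) =>
      ⨅ q ∈ L k, ⨆ i : ι, edist (p i) (q i)) p hp) (le_iSup (fun k => ⨆ p ∈ U k,
        ⨅ q ∈ L k, ⨆ i : ι, edist (p i) (q i)) k)) hδ
  simp only [iInf_lt_iff] at h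
  obtain ⟨q, hq, h⟩ := h
  refine ⟨q, hq, fun i => ?_⟩
  have := lt_of_le_of_lt (le_iSup (fun i => edist (p i) (q i)) i) h
  rw [edist_dist, ENNReal.ofReal_lt_ofReal_iff_of_nonneg dist_nonneg, Real.dist_eq] at this
  exact this

theorem exists_hullOrZero_le_add {κ ι : Type} [Fintype ι] {VL VU : κ → Finset (ι → ℝ)}
    (hVL : ∀ k, ∀ p ∈ VL k, Subdist p) {δ : ℝ} (hδ0 : 0 ≤ δ)
    (hδ : gapInf (fun k => dwConv (VL k : Set (ι → ℝ))) (fun k => dwConv (VU k : Set (ι → ℝ)))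
      < ENNReal.ofReal δ)
    (k : κ) {b : ι → ℝ} (hb : b ∈ hullOrZero (VU k : Set (ι → ℝ))) :
    ∃ b' ∈ hullOrZero (VL k : Set (ι → ℝ)), ∀ o, b o ≤ b' o + δ := by
  unfold hullOrZero at hb
  split_ifs at hb with hV
  · obtain ⟨q, ⟨b', hb', hq⟩, h⟩ :=
      exists_edist_lt_of_gapInf_lt hδ (k := k) (p := b) ⟨b, hb, le_rfl⟩
    have hne : (VL k : Set (ι → ℝ)).Nonempty := convexHull_nonempty_iff.1 ⟨b', hb'⟩
    refine ⟨b', by rw [hullOrZero, if_pos hne]; exact hb', fun o => ?_⟩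
    have h1 := (abs_lt.1 (h o)).2
    have h2 := hq o
    linarith
  · rw [Set.mem_singleton_iff] at hb
    subst hb
    obtain ⟨b', hb'⟩ := hullOrZero_nonempty (VL k : Set (ι → ℝ))
    refine ⟨b', hb', fun o => ?_⟩
    have := (subdist_of_mem_hullOrZero (hVL k) hb').1 o
    simp only [Pi.zero_apply]
    linarith

section ShortcutComp

variable {S₁ A₁ S₂ A₂ : Type}

/-- The sequential composition of two shortcut open MDPs. -/
noncomputable abbrev shortcutComp (𝒜 : OMDP S₁ A₁) (ℬ : OMDP S₂ A₂)
    (VA : 𝒜.EntrIdx → Finset (𝒜.ExitIdx → ℝ)) (VB : ℬ.EntrIdx → Finset (ℬ.ExitIdx → ℝ))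
    [Fintype S₁] [Fintype A₁] [Fintype S₂] [Fintype A₂]
    (g₁ : (𝒜.shortcut VA).Or.length = (ℬ.shortcut VB).Ir.length)
    (g₂ : (ℬ.shortcut VB).Ol.length = (𝒜.shortcut VA).Il.length) :=
  (𝒜.shortcut VA).seqComp (ℬ.shortcut VB) g₁ g₂

variable [Fintype S₁] [Fintype A₁] [Fintype S₂] [Fintype A₂]
  {𝒜 : OMDP S₁ A₁} {ℬ : OMDP S₂ A₂}

/-- The exits of the left shortcut are linked injectively to the entrances of the right one,
independently of the families of points defining the shortcuts. -/
theorem exists_link (hAOl : 𝒜.Ol = []) (hB : ℬ.Ir.Nodup)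
    (h : 𝒜.Or.length = ℬ.Ir.length) :
    ∃ φ : 𝒜.ExitIdx → ℬ.EntrIdx, Function.Injective φ ∧ ∀ VA VB g₁ g₂ j a,
      (shortcutComp 𝒜 ℬ VA VB g₁ g₂).M.P (Sum.inl (some j.1)) a =
        some fun t => if t = Sum.inr (some (φ j).1) then 1 else 0 := by
  have hlen : (𝒜.Or.map some).length = (ℬ.Ir.map some).length := by simpa using h
  have hj : ∀ j : 𝒜.ExitIdx, ∃ k : Fin (𝒜.Or.map some).length,
      (𝒜.Or.map some).get k = some j.1 := by
    intro j
    have : j.1 ∈ 𝒜.Or := by simpa [exit, hAOl] using j.2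
    exact List.mem_iff_get.1 (List.mem_map_of_mem this)
  have hi : ∀ j : 𝒜.ExitIdx, ∃ i : ℬ.EntrIdx,
      (ℬ.Ir.map some).get (Fin.cast hlen (hj j).choose) = some i.1 := by
    intro j
    have := List.get_mem (ℬ.Ir.map some) (Fin.cast hlen (hj j).choose)
    obtain ⟨i, hi, he⟩ := List.mem_map.1 this
    exact ⟨⟨i, by simp [entr, hi]⟩, he.symm⟩
  choose φ hφ using hi
  refine ⟨φ, fun j j' hjj => ?_, fun VA VB g₁ g₂ j a => ?_⟩
  · have e : (ℬ.Ir.map some).get (Fin.cast hlen (hj j).choose) =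
        (ℬ.Ir.map some).get (Fin.cast hlen (hj j').choose) := by rw [hφ, hφ, hjj]
    have e2 := (List.nodup_iff_injective_get.1 (hB.map (Option.some_injective _))) e
    have e3 : (hj j).choose = (hj j').choose := Fin.cast_injective hlen e2
    have e4 := (hj j).choose_spec
    rw [e3, (hj j').choose_spec] at e4
    exact Subtype.ext (Option.some_injective _ e4.symm)
  · have hj' : ∃ k : Fin (𝒜.shortcut VA).Or.length, (𝒜.shortcut VA).Or.get k = some j.1 := hj j
    simp only [shortcutComp, seqComp]
    rw [dif_pos hj', ← hφ j]
    refine congrArg some (funext fun t => ?_)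
    by_cases ht : t = Sum.inr ((ℬ.shortcut VB).Ir.get (Fin.cast g₁ hj'.choose))
    · rw [if_pos ht]
      exact (if_pos ht).symm
    · rw [if_neg ht]
      exact (if_neg ht).symm

variable {VA : 𝒜.EntrIdx → Finset (𝒜.ExitIdx → ℝ)} {VB : ℬ.EntrIdx → Finset (ℬ.ExitIdx → ℝ)}
  {g₁ : (𝒜.shortcut VA).Or.length = (ℬ.shortcut VB).Ir.length}
  {g₂ : (ℬ.shortcut VB).Ol.length = (𝒜.shortcut VA).Il.length}

theorem P_inl_of_not_mem {t : Option S₁} (ht : ∀ i ∈ 𝒜.entr, t ≠ some i)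
    (ht' : ∀ i ∈ 𝒜.Or, t ≠ some i) (a) :
    (shortcutComp 𝒜 ℬ VA VB g₁ g₂).M.P (Sum.inl t) a = none := by
  have : ¬∃ k : Fin (𝒜.shortcut VA).Or.length, (𝒜.shortcut VA).Or.get k = t := by
    rintro ⟨k, hk⟩
    have := List.get_mem _ k
    rw [hk] at this
    obtain ⟨i, hi, he⟩ := List.mem_map.1 this
    exact ht' i hi he.symm
  simp only [shortcutComp, seqComp]
  rw [dif_neg this]
  cases a with
  | inr _ => rfl
  | inl p =>
    cases t with
    | none => rfl
    | some s =>
      have hs : s ∉ 𝒜.entr := fun h => ht s h rfl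
      simp [shortcut, hs]

theorem P_inl_entr {s : S₁} (hs : s ∈ 𝒜.entr) (hs' : s ∉ 𝒜.Or) (a) :
    (shortcutComp 𝒜 ℬ VA VB g₁ g₂).M.P (Sum.inl (some s)) a =
      match a with
      | Sum.inr _ => none
      | Sum.inl p => if p.1 ∈ VA ⟨s, hs⟩ then
          some (Sum.elim (fun t => match t with
            | none => 1 - ∑ j, p.1 j
            | some s' => ∑ j : 𝒜.ExitIdx, if j.1 = s' then p.1 j else 0) fun _ => 0)
          else none := by
  have : ¬∃ k : Fin (𝒜.shortcut VA).Or.length, (𝒜.shortcut VA).Or.get k = some s := by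
    rintro ⟨k, hk⟩
    have := List.get_mem _ k
    rw [hk] at this
    simp [shortcut, hs'] at this
  simp only [shortcutComp, seqComp]
  rw [dif_neg this]
  cases a with
  | inr _ => rfl
  | inl p =>
    by_cases hp : p.1 ∈ VA ⟨s, hs⟩
    · simp [shortcut, hp, hs]
    · simp [shortcut, hp]

theorem P_inr_of_not_mem {t : Option S₂} (ht : ∀ i ∈ ℬ.entr, t ≠ some i) (hB : ℬ.Ol = []) (a) :
    (shortcutComp 𝒜 ℬ VA VB g₁ g₂).M.P (Sum.inr t) a = none := by
  have : ¬∃ k : Fin (ℬ.shortcut VB).Ol.length, (ℬ.shortcut VB).Ol.get k = t := by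
    rintro ⟨k, hk⟩
    have := List.get_mem _ k
    simp [shortcut, hB] at this
  simp only [shortcutComp, seqComp]
  rw [dif_neg this]
  cases a with
  | inl _ => rfl
  | inr p =>
    cases t with
    | none => rfl
    | some s =>
      have hs : s ∉ ℬ.entr := fun h => ht s h rfl
      simp [shortcut, hs]

theorem P_inr_entr {s : S₂} (hs : s ∈ ℬ.entr) (hB : ℬ.Ol = []) (a) :
    (shortcutComp 𝒜 ℬ VA VB g₁ g₂).M.P (Sum.inr (some s)) a =
      match a with
      | Sum.inl _ => none
      | Sum.inr p => if p.1 ∈ VB ⟨s, hs⟩ then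
          some (Sum.elim (fun _ => 0) fun t => match t with
            | none => 1 - ∑ j, p.1 j
            | some s' => ∑ j : ℬ.ExitIdx, if j.1 = s' then p.1 j else 0)
          else none := by
  have : ¬∃ k : Fin (ℬ.shortcut VB).Ol.length, (ℬ.shortcut VB).Ol.get k = some s := by
    rintro ⟨k, hk⟩
    have := List.get_mem _ k
    simp [shortcut, hB] at this
  simp only [shortcutComp, seqComp]
  rw [dif_neg this]
  cases a with
  | inl _ => rfl
  | inr p =>
    by_cases hp : p.1 ∈ VB ⟨s, hs⟩
    · simp [shortcut, hp, hs]
    · simp [shortcut, hp]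

theorem sum_option_exit {S A : Type} [Fintype S] {𝒳 : OMDP S A} (p : 𝒳.ExitIdx → ℝ)
    (f : S → ℝ) :
    ∑ s, (∑ j : 𝒳.ExitIdx, if j.1 = s then p j else 0) * f s = ∑ j, p j * f j.1 := by
  simp only [Finset.sum_mul]
  rw [Finset.sum_comm]
  refine Finset.sum_congr rfl fun j _ => ?_
  simp [ite_mul]

theorem sum_prob_inl {s : S₁} (hs : s ∈ 𝒜.entr) (hs' : s ∉ 𝒜.Or) (a)
    (f : Option S₁ ⊕ Option S₂ → ℝ) (hf : f (Sum.inl none) = 0) :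
    ∑ t, (shortcutComp 𝒜 ℬ VA VB g₁ g₂).M.prob (Sum.inl (some s)) a t * f t =
      match a with
      | Sum.inr _ => 0
      | Sum.inl p => if p.1 ∈ VA ⟨s, hs⟩ then ∑ j, p.1 j * f (Sum.inl (some j.1)) else 0 := by
  unfold MDP.prob
  rw [P_inl_entr hs hs']
  cases a with
  | inr _ => simp
  | inl p =>
    dsimp only
    split_ifs
    · simp only [Option.elim_some, Fintype.sum_sum_type, Sum.elim_inl, Sum.elim_inr, zero_mul,
        Finset.sum_const_zero, add_zero, Fintype.sum_option, hf, mul_zero, zero_add]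
      exact sum_option_exit p.1 fun s => f (Sum.inl (some s))
    · simp

theorem sum_prob_inr {s : S₂} (hs : s ∈ ℬ.entr) (hB : ℬ.Ol = []) (a)
    (f : Option S₁ ⊕ Option S₂ → ℝ) (hf : f (Sum.inr none) = 0) :
    ∑ t, (shortcutComp 𝒜 ℬ VA VB g₁ g₂).M.prob (Sum.inr (some s)) a t * f t =
      match a with
      | Sum.inl _ => 0
      | Sum.inr p => if p.1 ∈ VB ⟨s, hs⟩ then ∑ j, p.1 j * f (Sum.inr (some j.1)) else 0 := by
  unfold MDP.prob
  rw [P_inr_entr hs hB]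
  cases a with
  | inl _ => simp
  | inr p =>
    dsimp only
    split_ifs
    · simp only [Option.elim_some, Fintype.sum_sum_type, Sum.elim_inl, Sum.elim_inr, zero_mul,
        Finset.sum_const_zero, zero_add, Fintype.sum_option, hf, mul_zero]
      exact sum_option_exit p.1 fun s => f (Sum.inr (some s))
    · simp

theorem last_snoc {S A : Type} (π : FinPath S A) (a : A) (s : S) : (π.snoc a s).last = s := by
  simp [FinPath.last, FinPath.snoc]

theorem reachN_of_mem {S A : Type} [Fintype S] [Fintype A] {M : MDP S A} {σ : Sched S A}
    {T : Set S} {π : FinPath S A} (h : π.last ∈ T) (n : ℕ) : M.reachN σ T n π = 1 := by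
  cases n <;> simp [MDP.reachN, h]

theorem reachN_of_stuck {S A : Type} [Fintype S] [Fintype A] {M : MDP S A} {σ : Sched S A}
    {T : Set S} {π : FinPath S A} (h : π.last ∉ T) (hP : ∀ a, M.P π.last a = none) (n : ℕ) :
    M.reachN σ T n π = 0 := by
  cases n <;> simp [MDP.reachN, h, MDP.prob, hP]

section Reach

variable (hBOl : ℬ.Ol = []) (hBdis : ∀ i ∈ ℬ.entr, i ∉ ℬ.exit)
  (hAdis : ∀ i ∈ 𝒜.entr, i ∉ 𝒜.Or)
  {σ : Sched (Option S₁ ⊕ Option S₂) (𝒜.ShortAct VA ⊕ ℬ.ShortAct VB)}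

/-- The probability to move to the exit `o` when playing `σ` after `π` at an entrance `i` of
the right shortcut. -/
noncomputable def rightValue (σ : Sched (Option S₁ ⊕ Option S₂) (𝒜.ShortAct VA ⊕ ℬ.ShortAct VB))
    (π : FinPath (Option S₁ ⊕ Option S₂) (𝒜.ShortAct VA ⊕ ℬ.ShortAct VB)) (i : ℬ.EntrIdx)
    (o : ℬ.ExitIdx) : ℝ :=
  ∑ p : ℬ.ShortAct VB, (if p.1 ∈ VB i then σ π (Sum.inr p) else 0) * p.1 o

include hBOl hBdis in
theorem reachN_right (o : ℬ.ExitIdx)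
    {π : FinPath (Option S₁ ⊕ Option S₂) (𝒜.ShortAct VA ⊕ ℬ.ShortAct VB)} (i : ℬ.EntrIdx)
    (hπ : π.last = Sum.inr (some i.1)) (n : ℕ) :
    (shortcutComp 𝒜 ℬ VA VB g₁ g₂).M.reachN σ {Sum.inr (some o.1)} n π =
      if n = 0 then 0 else rightValue σ π i o := by
  have hT : π.last ∉ ({Sum.inr (some o.1)} : Set (Option S₁ ⊕ Option S₂)) := by
    rw [hπ, Set.mem_singleton_iff]
    intro h
    have : i.1 = o.1 := by simpa using h
    exact hBdis i.1 i.2 (this ▸ o.2)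
  cases n with
  | zero => simp [MDP.reachN, hT]
  | succ n =>
    simp only [MDP.reachN, hT, if_false, Nat.succ_ne_zero]
    rw [hπ, Fintype.sum_sum_type]
    have hnone : ∀ a, (shortcutComp 𝒜 ℬ VA VB g₁ g₂).M.reachN σ {Sum.inr (some o.1)} n
        (π.snoc a (Sum.inr none)) = 0 := fun a =>
      reachN_of_stuck (by simp [last_snoc])
        (fun b => by rw [last_snoc]; exact P_inr_of_not_mem (by simp) hBOl b) n
    have hexit : ∀ a (j : ℬ.ExitIdx), (shortcutComp 𝒜 ℬ VA VB g₁ g₂).M.reachN σ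
        {Sum.inr (some o.1)} n (π.snoc a (Sum.inr (some j.1))) = if j = o then 1 else 0 := by
      intro a j
      split_ifs with hjo
      · exact reachN_of_mem (by simp [last_snoc, hjo]) n
      · refine reachN_of_stuck ?_ (fun b => ?_) n
        · rw [last_snoc]
          simpa [Subtype.ext_iff] using hjo
        · rw [last_snoc]
          refine P_inr_of_not_mem (fun i hi h => hBdis i hi ?_) hBOl b
          rw [← Option.some_injective _ h]
          exact j.2
    have hstep := fun a => sum_prob_inr (g₁ := g₁) (g₂ := g₂) i.2 hBOl a (fun t =>
      (shortcutComp 𝒜 ℬ VA VB g₁ g₂).M.reachN σ {Sum.inr (some o.1)} n (π.snoc a t)) (hnone a)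
    beta_reduce at hstep
    simp only [hstep, hexit]
    simp only [mul_zero, Finset.sum_const_zero, zero_add, rightValue]
    refine Finset.sum_congr rfl fun p _ => ?_
    split_ifs <;> simp

/-- The expected value of `rightValue` when playing `σ` after `π` at an exit of the left shortcut
linked to the entrance `i` of the right one. -/
noncomputable def linkValue (σ : Sched (Option S₁ ⊕ Option S₂) (𝒜.ShortAct VA ⊕ ℬ.ShortAct VB))
    (π : FinPath (Option S₁ ⊕ Option S₂) (𝒜.ShortAct VA ⊕ ℬ.ShortAct VB)) (i : ℬ.EntrIdx)
    (o : ℬ.ExitIdx) : ℝ :=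
  ∑ a, σ π a * rightValue σ (π.snoc a (Sum.inr (some i.1))) i o

variable {φ : 𝒜.ExitIdx → ℬ.EntrIdx}
  (hφ : ∀ j a, (shortcutComp 𝒜 ℬ VA VB g₁ g₂).M.P (Sum.inl (some j.1)) a =
    some fun t => if t = Sum.inr (some (φ j).1) then 1 else 0)

include hBOl hBdis hφ in
theorem reachN_link (o : ℬ.ExitIdx)
    {π : FinPath (Option S₁ ⊕ Option S₂) (𝒜.ShortAct VA ⊕ ℬ.ShortAct VB)} (j : 𝒜.ExitIdx)
    (hπ : π.last = Sum.inl (some j.1)) (n : ℕ) :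
    (shortcutComp 𝒜 ℬ VA VB g₁ g₂).M.reachN σ {Sum.inr (some o.1)} n π =
      if n ≤ 1 then 0 else linkValue σ π (φ j) o := by
  have hT : π.last ∉ ({Sum.inr (some o.1)} : Set (Option S₁ ⊕ Option S₂)) := by
    simp [hπ]
  cases n with
  | zero => simp [MDP.reachN, hT]
  | succ n =>
    simp only [MDP.reachN, hT, if_false]
    rw [hπ]
    have : ∀ a, ∑ t, (shortcutComp 𝒜 ℬ VA VB g₁ g₂).M.prob (Sum.inl (some j.1)) a t *
        (shortcutComp 𝒜 ℬ VA VB g₁ g₂).M.reachN σ {Sum.inr (some o.1)} n (π.snoc a t) =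
        (shortcutComp 𝒜 ℬ VA VB g₁ g₂).M.reachN σ {Sum.inr (some o.1)} n
          (π.snoc a (Sum.inr (some (φ j).1))) := by
      intro a
      simp only [MDP.prob, hφ, Option.elim_some, ite_mul, one_mul, zero_mul]
      rw [Finset.sum_ite_eq' Finset.univ, if_pos (Finset.mem_univ _)]
    simp only [this, reachN_right hBOl hBdis o (φ j) (last_snoc _ _ _)]
    by_cases hn : n = 0
    · simp [hn]
    · have : ¬ n + 1 ≤ 1 := by omega
      simp [hn, linkValue]

/-- The probability to reach the exit `o` from the entrance `s` of the left shortcut. -/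
noncomputable def leftValue (σ : Sched (Option S₁ ⊕ Option S₂) (𝒜.ShortAct VA ⊕ ℬ.ShortAct VB))
    (φ : 𝒜.ExitIdx → ℬ.EntrIdx) (s : 𝒜.EntrIdx) (o : ℬ.ExitIdx) : ℝ :=
  ∑ p : 𝒜.ShortAct VA, (if p.1 ∈ VA s then σ ⟨Sum.inl (some s.1), []⟩ (Sum.inl p) else 0) *
    ∑ j, p.1 j * linkValue σ ⟨Sum.inl (some s.1), [(Sum.inl p, Sum.inl (some j.1))]⟩ (φ j) o

include hBOl hBdis hAdis hφ in
theorem reachN_left (o : ℬ.ExitIdx) (s : 𝒜.EntrIdx) (n : ℕ) :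
    (shortcutComp 𝒜 ℬ VA VB g₁ g₂).M.reachN σ {Sum.inr (some o.1)} n
      ⟨Sum.inl (some s.1), []⟩ = if n ≤ 2 then 0 else leftValue σ φ s o := by
  have hT : FinPath.last (⟨Sum.inl (some s.1), []⟩ :
      FinPath (Option S₁ ⊕ Option S₂) (𝒜.ShortAct VA ⊕ ℬ.ShortAct VB)) ∉
      ({Sum.inr (some o.1)} : Set (Option S₁ ⊕ Option S₂)) := by
    simp [FinPath.last]
  cases n with
  | zero => simp [MDP.reachN, hT]
  | succ n =>
    simp only [MDP.reachN, hT, if_false]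
    have hlast : FinPath.last (⟨Sum.inl (some s.1), []⟩ :
      FinPath (Option S₁ ⊕ Option S₂) (𝒜.ShortAct VA ⊕ ℬ.ShortAct VB)) =
        Sum.inl (some s.1) := rfl
    rw [hlast, Fintype.sum_sum_type]
    have hnone : ∀ a, (shortcutComp 𝒜 ℬ VA VB g₁ g₂).M.reachN σ {Sum.inr (some o.1)} n
        (FinPath.snoc ⟨Sum.inl (some s.1), []⟩ a (Sum.inl none)) = 0 := fun a =>
      reachN_of_stuck (by simp [last_snoc])
        (fun b => by rw [last_snoc]; exact P_inl_of_not_mem (by simp) (by simp) b) n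
    have hstep := fun a => sum_prob_inl (g₁ := g₁) (g₂ := g₂) s.2 (hAdis _ s.2) a (fun t =>
      (shortcutComp 𝒜 ℬ VA VB g₁ g₂).M.reachN σ {Sum.inr (some o.1)} n
        (FinPath.snoc ⟨Sum.inl (some s.1), []⟩ a t)) (hnone a)
    beta_reduce at hstep
    simp only [hstep,
      reachN_link hBOl hBdis hφ o _ (last_snoc _ _ _)]
    by_cases hn : n ≤ 1
    · simp [hn]
    · have : ¬ n + 1 ≤ 2 := by omega
      simp only [hn, this, if_false, mul_zero, Finset.sum_const_zero, add_zero, leftValue]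
      refine Finset.sum_congr rfl fun p _ => ?_
      split_ifs <;> simp [FinPath.snoc]

include hBOl hBdis hAdis hφ in
theorem Pr_left (o : ℬ.ExitIdx) (s : 𝒜.EntrIdx) (h0 : 0 ≤ leftValue σ φ s o) :
    (shortcutComp 𝒜 ℬ VA VB g₁ g₂).M.Pr σ (Sum.inl (some s.1)) {Sum.inr (some o.1)} =
      leftValue σ φ s o := by
  unfold MDP.Pr
  have hle : ∀ n, (shortcutComp 𝒜 ℬ VA VB g₁ g₂).M.reachN σ {Sum.inr (some o.1)} n
      ⟨Sum.inl (some s.1), []⟩ ≤ leftValue σ φ s o := by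
    intro n
    rw [reachN_left hBOl hBdis hAdis hφ]
    split_ifs
    · exact h0
    · exact le_rfl
  refine le_antisymm (ciSup_le hle) ?_
  refine le_trans (le_of_eq ?_) (le_ciSup ⟨_, Set.forall_mem_range.2 hle⟩ 3)
  rw [reachN_left hBOl hBdis hAdis hφ]
  simp

theorem consistent_snoc {S A : Type} [Fintype S] [Fintype A] {M : MDP S A} {π : FinPath S A}
    (h : M.Consistent π) {a : A} {t : S} (hp : M.prob π.last a t ≠ 0) :
    M.Consistent (π.snoc a t) := by
  obtain ⟨s, l⟩ := π
  induction l generalizing s with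
  | nil => exact ⟨hp, trivial⟩
  | cons x l ih =>
    refine ⟨h.1, ih x.2 h.2 ?_⟩
    convert hp using 2
    simp only [FinPath.last, List.map_cons]
    cases h : l.map Prod.snd <;> simp [List.getLastD]

include hBOl in
theorem choiceWeights_right (hσ : (shortcutComp 𝒜 ℬ VA VB g₁ g₂).M.IsSched σ)
    {π : FinPath (Option S₁ ⊕ Option S₂) (𝒜.ShortAct VA ⊕ ℬ.ShortAct VB)}
    (hc : (shortcutComp 𝒜 ℬ VA VB g₁ g₂).M.Consistent π) (i : ℬ.EntrIdx)
    (hπ : π.last = Sum.inr (some i.1)) :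
    ChoiceWeights (VB i : Set (ℬ.ExitIdx → ℝ))
      (fun p : ℬ.ShortAct VB => if p.1 ∈ VB i then σ π (Sum.inr p) else 0) := by
  obtain ⟨h0, hen, h1⟩ := hσ π hc
  refine ⟨fun p => ?_, fun p hp => ?_, fun ⟨q, hq⟩ => ?_⟩
  · split_ifs
    · exact h0 _
    · exact le_rfl
  · by_contra h
    exact hp (if_neg h)
  · have hnt : ¬(shortcutComp 𝒜 ℬ VA VB g₁ g₂).M.terminal π.last := by
      intro h
      have := h (Sum.inr ⟨q, i, hq⟩)
      rw [hπ, P_inr_entr i.2 hBOl] at this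
      have hq' : q ∈ VB i := hq
      simp [hq'] at this
    rw [← h1 hnt, Fintype.sum_sum_type]
    have hl : ∀ a, σ π (Sum.inl a) = 0 := by
      intro a
      by_contra h
      refine hen _ h ?_
      rw [hπ, P_inr_entr i.2 hBOl]
    simp only [hl, Finset.sum_const_zero, zero_add]
    refine Finset.sum_congr rfl fun p _ => ?_
    split_ifs with hp
    · rfl
    · by_contra h
      refine hen _ (Ne.symm h) ?_
      rw [hπ, P_inr_entr i.2 hBOl]
      exact if_neg hp

include hAdis in
theorem choiceWeights_left (hσ : (shortcutComp 𝒜 ℬ VA VB g₁ g₂).M.IsSched σ)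
    {π : FinPath (Option S₁ ⊕ Option S₂) (𝒜.ShortAct VA ⊕ ℬ.ShortAct VB)}
    (hc : (shortcutComp 𝒜 ℬ VA VB g₁ g₂).M.Consistent π) (s : 𝒜.EntrIdx)
    (hπ : π.last = Sum.inl (some s.1)) :
    ChoiceWeights (VA s : Set (𝒜.ExitIdx → ℝ))
      (fun p : 𝒜.ShortAct VA => if p.1 ∈ VA s then σ π (Sum.inl p) else 0) := by
  obtain ⟨h0, hen, h1⟩ := hσ π hc
  refine ⟨fun p => ?_, fun p hp => ?_, fun ⟨q, hq⟩ => ?_⟩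
  · split_ifs
    · exact h0 _
    · exact le_rfl
  · by_contra h
    exact hp (if_neg h)
  · have hnt : ¬(shortcutComp 𝒜 ℬ VA VB g₁ g₂).M.terminal π.last := by
      intro h
      have := h (Sum.inl ⟨q, s, hq⟩)
      rw [hπ, P_inl_entr s.2 (hAdis _ s.2)] at this
      have hq' : q ∈ VA s := hq
      simp [hq'] at this
    rw [← h1 hnt, Fintype.sum_sum_type]
    have hr : ∀ a, σ π (Sum.inr a) = 0 := by
      intro a
      by_contra h
      refine hen _ h ?_
      rw [hπ, P_inl_entr s.2 (hAdis _ s.2)]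
    simp only [hr, Finset.sum_const_zero, add_zero]
    refine Finset.sum_congr rfl fun p _ => ?_
    split_ifs with hp
    · rfl
    · by_contra h
      refine hen _ (Ne.symm h) ?_
      rw [hπ, P_inl_entr s.2 (hAdis _ s.2)]
      exact if_neg hp

include hBOl hφ in
theorem linkValue_mem [Nonempty (𝒜.ShortAct VA ⊕ ℬ.ShortAct VB)]
    (hσ : (shortcutComp 𝒜 ℬ VA VB g₁ g₂).M.IsSched σ)
    {π : FinPath (Option S₁ ⊕ Option S₂) (𝒜.ShortAct VA ⊕ ℬ.ShortAct VB)}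
    (hc : (shortcutComp 𝒜 ℬ VA VB g₁ g₂).M.Consistent π) (j : 𝒜.ExitIdx)
    (hπ : π.last = Sum.inl (some j.1)) :
    linkValue σ π (φ j) ∈ hullOrZero (VB (φ j) : Set (ℬ.ExitIdx → ℝ)) := by
  obtain ⟨h0, -, h1⟩ := hσ π hc
  refine sum_mem_of_weights (convex_hullOrZero _) (σ π)
    (fun a => rightValue σ (π.snoc a (Sum.inr (some (φ j).1))) (φ j)) h0 (h1 ?_) fun a _ => ?_
  · intro h
    have := h (Classical.arbitrary _)
    rw [hπ, hφ] at this
    cases this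
  · refine (choiceWeights_right hBOl hσ (consistent_snoc hc ?_) (φ j) (last_snoc _ _ _)).sum_mem
    rw [hπ]
    simp [MDP.prob, hφ]

include hBOl hAdis hφ in
/-- The reachability probabilities under a scheduler are the composition of points in the
convex hulls of the shortcut points. -/
theorem exists_leftValue_eq (hVA : ∀ k, ∀ p ∈ VA k, Subdist p) (hinj : Function.Injective φ)
    (hσ : (shortcutComp 𝒜 ℬ VA VB g₁ g₂).M.IsSched σ) (s : 𝒜.EntrIdx) :
    ∃ a ∈ hullOrZero (VA s : Set (𝒜.ExitIdx → ℝ)), ∃ b : ℬ.EntrIdx → ℬ.ExitIdx → ℝ,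
      (∀ i, b i ∈ hullOrZero (VB i : Set (ℬ.ExitIdx → ℝ))) ∧
        ∀ o, leftValue σ φ s o = ∑ j, a j * b (φ j) o := by
  have hc₀ : (shortcutComp 𝒜 ℬ VA VB g₁ g₂).M.Consistent ⟨Sum.inl (some s.1), []⟩ := trivial
  have hw := choiceWeights_left hAdis hσ hc₀ s rfl
  set w : 𝒜.ShortAct VA → ℝ :=
    fun p => if p.1 ∈ VA s then σ ⟨Sum.inl (some s.1), []⟩ (Sum.inl p) else 0 with hwdef
  have hb : ∀ j, ∃ b ∈ hullOrZero (VB (φ j) : Set (ℬ.ExitIdx → ℝ)), ∀ o,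
      ∑ p, (w p * p.1 j) *
        linkValue σ ⟨Sum.inl (some s.1), [(Sum.inl p, Sum.inl (some j.1))]⟩ (φ j) o =
      (∑ p, w p * p.1 j) * b o := by
    intro j
    refine exists_sum_eq_mul (convex_hullOrZero _) (hullOrZero_nonempty _) _
      (fun p : 𝒜.ShortAct VA =>
        linkValue σ ⟨Sum.inl (some s.1), [(Sum.inl p, Sum.inl (some j.1))]⟩ (φ j))
      (fun p => ?_) fun p hp => ?_
    · obtain ⟨k, hk⟩ := p.2
      exact mul_nonneg (hw.nonneg p) ((hVA k p.1 hk).1 j)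
    · have : Nonempty (𝒜.ShortAct VA ⊕ ℬ.ShortAct VB) := ⟨Sum.inl p⟩
      have hpm := hw.mem p (left_ne_zero_of_mul hp)
      refine linkValue_mem hBOl hφ hσ ?_ j rfl
      refine (show _ ∧ True from ⟨?_, trivial⟩)
      have hpm' : p.1 ∈ VA s := hpm
      unfold MDP.prob
      rw [P_inl_entr s.2 (hAdis _ s.2)]
      simpa [hpm', Subtype.coe_inj] using right_ne_zero_of_mul hp
  choose b₀ hb₀ hb₀e using hb
  choose d hd using fun i => hullOrZero_nonempty (VB i : Set (ℬ.ExitIdx → ℝ))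
  refine ⟨_, hw.sum_mem, fun i => if h : ∃ j, φ j = i then b₀ h.choose else d i,
    fun i => ?_, fun o => ?_⟩
  · dsimp only
    split_ifs with h
    · have := hb₀ h.choose
      rwa [h.choose_spec] at this
    · exact hd i
  · have hbφ : ∀ j, (if h : ∃ j', φ j' = φ j then b₀ h.choose else d (φ j)) = b₀ j := by
      intro j
      have h : ∃ j', φ j' = φ j := ⟨j, rfl⟩
      rw [dif_pos h, hinj h.choose_spec]
    simp only [hbφ, ← hb₀e]
    rw [Finset.sum_comm]
    unfold leftValue
    refine Finset.sum_congr rfl fun p _ => ?_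
    rw [Finset.mul_sum]
    exact Finset.sum_congr rfl fun j _ => by rw [mul_assoc]

include hBOl hAdis hφ in
/-- Every choice of points in the convex hulls is realised by a memoryless scheduler. -/
theorem exists_isSched_leftValue_eq (hAOl : 𝒜.Ol = [])
    {a : 𝒜.EntrIdx → 𝒜.ExitIdx → ℝ}
    (ha : ∀ k, a k ∈ hullOrZero (VA k : Set (𝒜.ExitIdx → ℝ)))
    {b : ℬ.EntrIdx → ℬ.ExitIdx → ℝ}
    (hb : ∀ i, b i ∈ hullOrZero (VB i : Set (ℬ.ExitIdx → ℝ))) :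
    ∃ σ, (shortcutComp 𝒜 ℬ VA VB g₁ g₂).M.IsSched σ ∧
      ∀ s o, leftValue σ φ s o = ∑ j, a s j * b (φ j) o := by
  choose wA hwA haA using fun k =>
    exists_choiceWeights (Q := fun p => ∃ k, p ∈ VA k) (fun p hp => ⟨k, hp⟩) (ha k)
  choose wB hwB hbB using fun k =>
    exists_choiceWeights (Q := fun p => ∃ k, p ∈ VB k) (fun p hp => ⟨k, hp⟩) (hb k)
  let act : Option S₁ ⊕ Option S₂ → (𝒜.ShortAct VA ⊕ ℬ.ShortAct VB) → ℝ := fun t x =>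
    match t with
    | Sum.inl t =>
      if ∃ i ∈ 𝒜.Or, t = some i then ((Fintype.card (𝒜.ShortAct VA ⊕ ℬ.ShortAct VB) : ℝ))⁻¹
      else if h : ∃ i : 𝒜.EntrIdx, t = some i.1 then Sum.elim (wA h.choose) (fun _ => 0) x else 0
    | Sum.inr t =>
      if h : ∃ i : ℬ.EntrIdx, t = some i.1 then Sum.elim (fun _ => 0) (wB h.choose) x else 0
  have act_link : ∀ (j : 𝒜.ExitIdx) x, act (Sum.inl (some j.1)) x =
      ((Fintype.card (𝒜.ShortAct VA ⊕ ℬ.ShortAct VB) : ℝ))⁻¹ := by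
    intro j x
    have hj : j.1 ∈ 𝒜.Or := by simpa [exit, hAOl] using j.2
    exact if_pos ⟨j.1, hj, rfl⟩
  have act_left : ∀ (i : 𝒜.EntrIdx) x, act (Sum.inl (some i.1)) x =
      Sum.elim (wA i) (fun _ => 0) x := by
    intro i x
    have hn : ¬∃ i' ∈ 𝒜.Or, some i.1 = some i' := by
      rintro ⟨i', hi', he⟩
      exact hAdis i.1 i.2 (Option.some_injective _ he ▸ hi')
    have h : ∃ i' : 𝒜.EntrIdx, some i.1 = some i'.1 := ⟨i, rfl⟩
    have he : h.choose = i := Subtype.ext (Option.some_injective _ h.choose_spec).symm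
    change (if _ then _ else dite _ _ _) = _
    rw [if_neg hn, dif_pos h, he]
  have act_right : ∀ (i : ℬ.EntrIdx) x, act (Sum.inr (some i.1)) x =
      Sum.elim (fun _ => 0) (wB i) x := by
    intro i x
    have h : ∃ i' : ℬ.EntrIdx, some i.1 = some i'.1 := ⟨i, rfl⟩
    have he : h.choose = i := Subtype.ext (Option.some_injective _ h.choose_spec).symm
    change dite _ _ _ = _
    rw [dif_pos h, he]
  refine ⟨fun π => act π.last, fun π _ => ?_, fun s o => ?_⟩
  · dsimp only
    generalize π.last = t
    rcases t with t | t
    · by_cases h1 : ∃ j : 𝒜.ExitIdx, t = some j.1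
      · obtain ⟨j, rfl⟩ := h1
        simp only [act_link]
        refine ⟨fun _ => by positivity, fun x _ => by simp [MDP.enabled, hφ], fun hnt => ?_⟩
        have hne : Nonempty (𝒜.ShortAct VA ⊕ ℬ.ShortAct VB) := by
          by_contra h
          exact hnt fun x => absurd ⟨x⟩ h
        rw [Finset.sum_const, Finset.card_univ, nsmul_eq_mul]
        exact mul_inv_cancel₀ (Nat.cast_ne_zero.2 Fintype.card_ne_zero)
      by_cases h2 : ∃ i : 𝒜.EntrIdx, t = some i.1
      · obtain ⟨i, rfl⟩ := h2
        simp only [act_left]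
        refine ⟨fun x => ?_, fun x hx => ?_, fun hnt => ?_⟩
        · cases x
          · exact (hwA i).nonneg _
          · exact le_rfl
        · cases x with
          | inl p =>
            have hp : p.1 ∈ VA i := (hwA i).mem p hx
            rw [MDP.enabled, P_inl_entr i.2 (hAdis _ i.2)]
            simp [hp]
          | inr p => exact absurd rfl hx
        · rw [Fintype.sum_sum_type]
          simp only [Sum.elim_inl, Sum.elim_inr, Finset.sum_const_zero, add_zero]
          refine (hwA i).sum_eq ?_
          by_contra hV
          refine hnt fun x => ?_
          rw [P_inl_entr i.2 (hAdis _ i.2)]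
          cases x with
          | inl p => exact if_neg fun hp => hV ⟨p.1, hp⟩
          | inr _ => rfl
      · have hP : ∀ x, (shortcutComp 𝒜 ℬ VA VB g₁ g₂).M.P (Sum.inl t) x = none :=
          P_inl_of_not_mem (fun i hi h => h2 ⟨⟨i, hi⟩, h⟩)
            fun i hi h => h1 ⟨⟨i, by simp [exit, hi]⟩, h⟩
        have hn : ¬∃ i ∈ 𝒜.Or, t = some i := by
          rintro ⟨i, hi, h⟩
          exact h1 ⟨⟨i, by simp [exit, hi]⟩, h⟩
        have hact : ∀ x, act (Sum.inl t) x = 0 := by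
          intro x
          change (if _ then _ else dite _ _ _) = _
          rw [if_neg hn, dif_neg h2]
        exact ⟨fun x => (hact x).ge, fun x hx => absurd (hact x) hx, fun hnt => absurd hP hnt⟩
    · by_cases h2 : ∃ i : ℬ.EntrIdx, t = some i.1
      · obtain ⟨i, rfl⟩ := h2
        simp only [act_right]
        refine ⟨fun x => ?_, fun x hx => ?_, fun hnt => ?_⟩
        · cases x
          · exact le_rfl
          · exact (hwB i).nonneg _
        · cases x with
          | inr p =>
            have hp : p.1 ∈ VB i := (hwB i).mem p hx
            rw [MDP.enabled, P_inr_entr i.2 hBOl]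
            simp [hp]
          | inl p => exact absurd rfl hx
        · rw [Fintype.sum_sum_type]
          simp only [Sum.elim_inl, Sum.elim_inr, Finset.sum_const_zero, zero_add]
          refine (hwB i).sum_eq ?_
          by_contra hV
          refine hnt fun x => ?_
          rw [P_inr_entr i.2 hBOl]
          cases x with
          | inr p => exact if_neg fun hp => hV ⟨p.1, hp⟩
          | inl _ => rfl
      · have hP : ∀ x, (shortcutComp 𝒜 ℬ VA VB g₁ g₂).M.P (Sum.inr t) x = none :=
          P_inr_of_not_mem (fun i hi h => h2 ⟨⟨i, hi⟩, h⟩) hBOl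
        have hact : ∀ x, act (Sum.inr t) x = 0 := fun x => dif_neg h2
        exact ⟨fun x => (hact x).ge, fun x hx => absurd (hact x) hx, fun hnt => absurd hP hnt⟩
  · have hright : ∀ (π : FinPath (Option S₁ ⊕ Option S₂) (𝒜.ShortAct VA ⊕ ℬ.ShortAct VB))
        (i : ℬ.EntrIdx), π.last = Sum.inr (some i.1) →
        rightValue (fun π => act π.last) π i o = b i o := by
      intro π i hπ
      simp only [rightValue, hπ, act_right, Sum.elim_inr]
      rw [← hbB i o]
      refine Finset.sum_congr rfl fun p _ => ?_
      congr 1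
      split_ifs with h
      · rfl
      · by_contra h'
        exact h ((hwB i).mem p (Ne.symm h'))
    have hlink : ∀ [Nonempty (𝒜.ShortAct VA ⊕ ℬ.ShortAct VB)]
        (π : FinPath (Option S₁ ⊕ Option S₂) (𝒜.ShortAct VA ⊕ ℬ.ShortAct VB))
        (j : 𝒜.ExitIdx), π.last = Sum.inl (some j.1) →
        linkValue (fun π => act π.last) π (φ j) o = b (φ j) o := by
      intro _ π j hπ
      simp only [linkValue, hright _ _ (last_snoc _ _ _), hπ, act_link]
      rw [Finset.sum_const, Finset.card_univ, nsmul_eq_mul, ← mul_assoc,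
        mul_inv_cancel₀ (Nat.cast_ne_zero.2 Fintype.card_ne_zero), one_mul]
    simp only [← haA, Finset.sum_mul]
    rw [Finset.sum_comm]
    unfold leftValue
    refine Finset.sum_congr rfl fun p _ => ?_
    have : Nonempty (𝒜.ShortAct VA ⊕ ℬ.ShortAct VB) := ⟨Sum.inl p⟩
    have hw : (if p.1 ∈ VA s then act (Sum.inl (some s.1)) (Sum.inl p) else 0) = wA s p := by
      rw [act_left, Sum.elim_inl]
      split_ifs with h
      · rfl
      · by_contra h'
        exact h ((hwA s).mem p (Ne.symm h'))
    change (if p.1 ∈ VA s then act (Sum.inl (some s.1)) (Sum.inl p) else 0) * _ = _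
    rw [hw, Finset.mul_sum]
    refine Finset.sum_congr rfl fun j _ => ?_
    rw [hlink _ _ rfl, mul_assoc]

end Reach

end ShortcutComp

theorem sum_mul_le_add {ι κ ω : Type} [Fintype ι] [Fintype ω] {φ : ι → κ} {a a' : ι → ℝ}
    {b b' : κ → ω → ℝ} (ha' : Subdist a') (hb : ∀ i, Subdist (b i)) {ε δ : ℝ} (hε : 0 ≤ ε)
    (hδ : 0 ≤ δ) (haa : ∀ j, a j ≤ a' j + ε) (hbb : ∀ i o, b i o ≤ b' i o + δ) (o : ω) :
    ∑ j, a j * b (φ j) o ≤ ∑ j, a' j * b' (φ j) o + Fintype.card ι * ε + δ := by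
  have hterm : ∀ j, a j * b (φ j) o ≤ a' j * b' (φ j) o + ε + δ * a' j := by
    intro j
    have hb0 := (hb (φ j)).1 o
    have hb1 : b (φ j) o ≤ 1 := le_trans
      (Finset.single_le_sum (fun o _ => (hb (φ j)).1 o) (Finset.mem_univ o)) (hb (φ j)).2
    have h1 := mul_le_mul_of_nonneg_right (haa j) hb0
    have h2 := mul_le_mul_of_nonneg_left (hbb (φ j) o) (ha'.1 j)
    have h3 := mul_le_mul_of_nonneg_left hb1 hε
    nlinarith
  refine (Finset.sum_le_sum fun j _ => hterm j).trans ?_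
  rw [Finset.sum_add_distrib, Finset.sum_add_distrib, ← Finset.mul_sum, Finset.sum_const,
    Finset.card_univ, nsmul_eq_mul]
  have := mul_le_mul_of_nonneg_left ha'.2 hδ
  linarith

theorem exists_exit_eq {S₁ A₁ S₂ A₂ : Type} [Fintype S₁] [Fintype A₁] [Fintype S₂] [Fintype A₂]
    {𝒜 : OMDP S₁ A₁} {ℬ : OMDP S₂ A₂} (hAOl : 𝒜.Ol = [])
    {VA : 𝒜.EntrIdx → Finset (𝒜.ExitIdx → ℝ)} {VB : ℬ.EntrIdx → Finset (ℬ.ExitIdx → ℝ)}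
    {g₁ : (𝒜.shortcut VA).Or.length = (ℬ.shortcut VB).Ir.length}
    {g₂ : (ℬ.shortcut VB).Ol.length = (𝒜.shortcut VA).Il.length}
    (x : (shortcutComp 𝒜 ℬ VA VB g₁ g₂).ExitIdx) :
    ∃ o : ℬ.ExitIdx, x.1 = Sum.inr (some o.1) := by
  obtain ⟨x, hx⟩ := x
  simp only [exit, shortcutComp, seqComp, shortcut, hAOl, List.map_nil, List.append_nil,
    List.mem_map] at hx
  obtain ⟨_, ⟨o, ho, rfl⟩, rfl⟩ := hx
  exact ⟨⟨o, by simp [exit, ho]⟩, rfl⟩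

theorem ofReal_toReal_add_gt {g : ℝ≥0∞} (hg : g ≠ ⊤) {η : ℝ} (hη : 0 < η) :
    g < ENNReal.ofReal (g.toReal + η) := by
  conv_lhs => rw [← ENNReal.ofReal_toReal hg]
  exact (ENNReal.ofReal_lt_ofReal_iff (by positivity)).2 (by linarith)

end SD

open SD in
/-- Let `𝒜`, `ℬ` be rightward open MDPs such that `𝒜 ⨟ ℬ` is
well-defined, let `(L^𝒜,U^𝒜)`, `(L^ℬ,U^ℬ)` be sound approximations of `𝒜`, `ℬ`
(given by vertex families of subdistributions), and let `(L^{𝒜⨟ℬ}, U_X)` be a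
sound approximation of `D(L^𝒜) ⨟ D(L^ℬ)` and `(L_X, U^{𝒜⨟ℬ})` a sound
approximation of `D(U^𝒜) ⨟ D(U^ℬ)`. Then
`gap_∞(L^{𝒜⨟ℬ}, U^{𝒜⨟ℬ}) ≤ |O^𝒜|·gap_∞(L^𝒜,U^𝒜) + gap_∞(L^ℬ,U^ℬ) +
gap_∞(L^{𝒜⨟ℬ}, U_X) + gap_∞(L_X, U^{𝒜⨟ℬ})`. -/
theorem statement_13 {S₁ A₁ S₂ A₂ : Type}
    [Fintype S₁] [Fintype A₁] [Fintype S₂] [Fintype A₂]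
    (𝒜 : OMDP S₁ A₁) (ℬ : OMDP S₂ A₂) (hWFA : 𝒜.WF) (hWFB : ℬ.WF)
    (hAIl : 𝒜.Il = []) (hAOl : 𝒜.Ol = []) (hBIl : ℬ.Il = []) (hBOl : ℬ.Ol = [])
    (h₁ : 𝒜.Or.length = ℬ.Ir.length) (h₂ : ℬ.Ol.length = 𝒜.Il.length)
    (VLA VUA : 𝒜.EntrIdx → Finset (𝒜.ExitIdx → ℝ))
    (VLB VUB : ℬ.EntrIdx → Finset (ℬ.ExitIdx → ℝ))
    (hVLA : ∀ k, ∀ p ∈ VLA k, Subdist p) (hVUA : ∀ k, ∀ p ∈ VUA k, Subdist p)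
    (hVLB : ∀ k, ∀ p ∈ VLB k, Subdist p) (hVUB : ∀ k, ∀ p ∈ VUB k, Subdist p)
    (hsoundA : ∀ k : 𝒜.EntrIdx,
      dwConv ((VLA k : Finset (𝒜.ExitIdx → ℝ)) : Set (𝒜.ExitIdx → ℝ)) ⊆ 𝒜.achievable k.1 ∧
        𝒜.achievable k.1 ⊆ dwConv ((VUA k : Finset (𝒜.ExitIdx → ℝ)) : Set (𝒜.ExitIdx → ℝ)))
    (hsoundB : ∀ k : ℬ.EntrIdx,
      dwConv ((VLB k : Finset (ℬ.ExitIdx → ℝ)) : Set (ℬ.ExitIdx → ℝ)) ⊆ ℬ.achievable k.1 ∧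
        ℬ.achievable k.1 ⊆ dwConv ((VUB k : Finset (ℬ.ExitIdx → ℝ)) : Set (ℬ.ExitIdx → ℝ)))
    (gL₁ : (𝒜.shortcut VLA).Or.length = (ℬ.shortcut VLB).Ir.length)
    (gL₂ : (ℬ.shortcut VLB).Ol.length = (𝒜.shortcut VLA).Il.length)
    (gU₁ : (𝒜.shortcut VUA).Or.length = (ℬ.shortcut VUB).Ir.length)
    (gU₂ : (ℬ.shortcut VUB).Ol.length = (𝒜.shortcut VUA).Il.length)
    (LC UX LX UC : (𝒜.seqComp ℬ h₁ h₂).EntrIdx →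
      Set (((𝒜.shortcut VLA).seqComp (ℬ.shortcut VLB) gL₁ gL₂).ExitIdx → ℝ))
    (hLCfg : ∀ k, ∃ V : Finset (((𝒜.shortcut VLA).seqComp (ℬ.shortcut VLB) gL₁ gL₂).ExitIdx → ℝ),
      LC k = dwConv (V : Set _))
    (hUXfg : ∀ k, ∃ V : Finset (((𝒜.shortcut VLA).seqComp (ℬ.shortcut VLB) gL₁ gL₂).ExitIdx → ℝ),
      UX k = dwConv (V : Set _))
    (hLXfg : ∀ k, ∃ V : Finset (((𝒜.shortcut VLA).seqComp (ℬ.shortcut VLB) gL₁ gL₂).ExitIdx → ℝ),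
      LX k = dwConv (V : Set _))
    (hUCfg : ∀ k, ∃ V : Finset (((𝒜.shortcut VLA).seqComp (ℬ.shortcut VLB) gL₁ gL₂).ExitIdx → ℝ),
      UC k = dwConv (V : Set _))
    (hsoundL : ∀ k : (𝒜.seqComp ℬ h₁ h₂).EntrIdx,
      LC k ⊆ ((𝒜.shortcut VLA).seqComp (ℬ.shortcut VLB) gL₁ gL₂).achievable
          (Sum.map some some k.1) ∧
        ((𝒜.shortcut VLA).seqComp (ℬ.shortcut VLB) gL₁ gL₂).achievable
            (Sum.map some some k.1) ⊆ UX k)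
    (hsoundU : ∀ k : (𝒜.seqComp ℬ h₁ h₂).EntrIdx,
      LX k ⊆ ((𝒜.shortcut VUA).seqComp (ℬ.shortcut VUB) gU₁ gU₂).achievable
          (Sum.map some some k.1) ∧
        ((𝒜.shortcut VUA).seqComp (ℬ.shortcut VUB) gU₁ gU₂).achievable
            (Sum.map some some k.1) ⊆ UC k) :
    gapInf LC UC ≤
      (𝒜.exit.length : ℝ≥0∞) *
          gapInf
            (fun k : 𝒜.EntrIdx =>
              dwConv ((VLA k : Finset (𝒜.ExitIdx → ℝ)) : Set (𝒜.ExitIdx → ℝ)))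
            (fun k : 𝒜.EntrIdx =>
              dwConv ((VUA k : Finset (𝒜.ExitIdx → ℝ)) : Set (𝒜.ExitIdx → ℝ))) +
        gapInf
          (fun k : ℬ.EntrIdx =>
            dwConv ((VLB k : Finset (ℬ.ExitIdx → ℝ)) : Set (ℬ.ExitIdx → ℝ)))
          (fun k : ℬ.EntrIdx =>
            dwConv ((VUB k : Finset (ℬ.ExitIdx → ℝ)) : Set (ℬ.ExitIdx → ℝ))) +
        gapInf LC UX + gapInf LX UC := by
  set n := 𝒜.exit.length with hn
  set gA := gapInf (fun k : 𝒜.EntrIdx => dwConv ((VLA k : Finset _) : Set (𝒜.ExitIdx → ℝ)))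
    (fun k : 𝒜.EntrIdx => dwConv ((VUA k : Finset _) : Set (𝒜.ExitIdx → ℝ))) with hgA
  set gB := gapInf (fun k : ℬ.EntrIdx => dwConv ((VLB k : Finset _) : Set (ℬ.ExitIdx → ℝ)))
    (fun k : ℬ.EntrIdx => dwConv ((VUB k : Finset _) : Set (ℬ.ExitIdx → ℝ))) with hgB
  have hAdis : ∀ i ∈ 𝒜.entr, i ∉ 𝒜.Or := by
    have h := hWFA.2.1
    intro i hi hi'
    rw [List.append_assoc] at h
    exact List.disjoint_of_nodup_append h hi (by simp [hi'])
  have hBdis : ∀ i ∈ ℬ.entr, i ∉ ℬ.exit := by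
    have h := hWFB.2.1
    rw [List.append_assoc] at h
    intro i hi hi'
    exact List.disjoint_of_nodup_append h hi hi'
  have hBIr : ℬ.Ir.Nodup := by
    have h := hWFB.2.1
    simp only [List.append_assoc] at h
    exact h.of_append_left
  obtain ⟨φ, hinj, hφ⟩ := exists_link hAOl hBIr h₁
  have hcard : (Fintype.card 𝒜.ExitIdx : ℝ) ≤ n := by
    have : Fintype.card 𝒜.ExitIdx ≤ n := by
      rw [Fintype.card_of_subtype 𝒜.exit.toFinset (by simp)]
      exact List.toFinset_card_le _
    exact_mod_cast this
  refine ENNReal.le_of_forall_pos_le_add fun ε hε hfin => ?_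
  obtain ⟨⟨⟨hAfin, hBfin⟩, h3fin⟩, h4fin⟩ : (((n : ℝ≥0∞) * gA < ⊤ ∧ gB < ⊤) ∧
      gapInf LC UX < ⊤) ∧ gapInf LX UC < ⊤ := by
    simpa only [ENNReal.add_lt_top] using hfin
  set η : ℝ := ε / (n + 3) with hη
  have hη0 : 0 < η := by positivity
  have hgap3 := ofReal_toReal_add_gt h3fin.ne hη0
  have hgap4 := ofReal_toReal_add_gt h4fin.ne hη0
  have hgapB := ofReal_toReal_add_gt hBfin.ne hη0
  have hpoint : ∀ k, ∀ p ∈ UC k, ∃ r ∈ LC k, ∀ x, |p x - r x| ≤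
      n * (gA.toReal + η) + (gB.toReal + η) + ((gapInf LC UX).toReal + η) +
        ((gapInf LX UC).toReal + η) := by
    intro k p hp
    obtain ⟨s, hs⟩ : ∃ s : 𝒜.EntrIdx, k.1 = Sum.inl s.1 := by
      obtain ⟨k, hk⟩ := k
      simp only [OMDP.entr, OMDP.seqComp, hBIl, List.map_nil, List.append_nil,
        List.mem_map] at hk
      obtain ⟨s, hs, rfl⟩ := hk
      exact ⟨⟨s, by simp [OMDP.entr, hs]⟩, rfl⟩
    obtain ⟨q, hq, hpq⟩ := exists_edist_lt_of_gapInf_lt hgap4 hp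
    obtain ⟨σ, hσ, hqσ⟩ := (hsoundU k).1 hq
    obtain ⟨a, ha, b, hb, hab⟩ :=
      exists_leftValue_eq hBOl hAdis (hφ VUA VUB gU₁ gU₂) hVUA hinj hσ s
    have haS := subdist_of_mem_hullOrZero (hVUA s) ha
    have hbS : ∀ i, Subdist (b i) := fun i => subdist_of_mem_hullOrZero (hVUB i) (hb i)
    obtain ⟨a', ha', haa⟩ : ∃ a' ∈ hullOrZero (VLA s : Set (𝒜.ExitIdx → ℝ)),
        ∀ j, a j ≤ a' j + (gA.toReal + η) := by
      rcases eq_or_ne n 0 with h0 | h0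
      · obtain ⟨a', ha'⟩ := hullOrZero_nonempty (VLA s : Set (𝒜.ExitIdx → ℝ))
        refine ⟨a', ha', fun j => ?_⟩
        exact absurd (List.length_pos_of_mem j.2) (by omega)
      · have hA : gA ≠ ⊤ := by
          rintro h
          rw [h, ENNReal.mul_top (by exact_mod_cast h0)] at hAfin
          exact lt_irrefl _ hAfin
        exact exists_hullOrZero_le_add hVLA (by positivity) (ofReal_toReal_add_gt hA hη0) s ha
    choose b' hb' hbb using fun i =>
      exists_hullOrZero_le_add hVLB (by positivity) hgapB i (hb i)
    choose d hd using fun k => hullOrZero_nonempty (VLA k : Set (𝒜.ExitIdx → ℝ))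
    obtain ⟨τ, hτ, hτe⟩ := exists_isSched_leftValue_eq hBOl hAdis (hφ VLA VLB gL₁ gL₂) hAOl
      (a := Function.update d s a') (b := b') (fun k => by
        rcases eq_or_ne k s with rfl | h
        · rwa [Function.update_self]
        · rw [Function.update_of_ne h]
          exact hd k) hb'
    replace hτe := hτe s
    simp only [Function.update_self] at hτe
    have ha'S := subdist_of_mem_hullOrZero (hVLA s) ha'
    have hb'S : ∀ i, Subdist (b' i) := fun i => subdist_of_mem_hullOrZero (hVLB i) (hb' i)
    have hσ0 : ∀ o, 0 ≤ leftValue σ φ s o := fun o => by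
      rw [hab]
      exact Finset.sum_nonneg fun j _ => mul_nonneg (haS.1 j) ((hbS _).1 o)
    have hτ0 : ∀ o, 0 ≤ leftValue τ φ s o := fun o => by
      rw [hτe]
      exact Finset.sum_nonneg fun j _ => mul_nonneg (ha'S.1 j) ((hb'S _).1 o)
    have hle : ∀ o, leftValue σ φ s o ≤
        leftValue τ φ s o + (n * (gA.toReal + η) + (gB.toReal + η)) := fun o => by
      rw [hab, hτe]
      have h1 := sum_mul_le_add (φ := φ) ha'S hbS (by positivity) (by positivity) haa hbb o
      have h2 := mul_le_mul_of_nonneg_right hcard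
        (show 0 ≤ gA.toReal + η by positivity)
      linarith
    set c := n * (gA.toReal + η) + (gB.toReal + η) with hc
    have hc0 : 0 ≤ c := by positivity
    have hmem : (fun x => q x - c) ∈ UX k := by
      refine (hsoundL k).2 ⟨τ, hτ, fun x => ?_⟩
      obtain ⟨o, ho⟩ := exists_exit_eq hAOl x
      have h1 : q x ≤ _ := hqσ x
      rw [hs] at h1 ⊢
      simp only [OMDP.prVec] at h1 ⊢
      rw [ho] at h1 ⊢
      have h2 := Pr_left hBOl hBdis hAdis (hφ VUA VUB gU₁ gU₂) o s (hσ0 o)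
      have h3 := Pr_left hBOl hBdis hAdis (hφ VLA VLB gL₁ gL₂) o s (hτ0 o)
      simp only [Sum.map_inl]
      have h1' := h1.trans h2.le
      refine le_trans ?_ h3.ge
      have := hle o
      linarith
    obtain ⟨r, hr, hrq⟩ := exists_edist_lt_of_gapInf_lt hgap3 hmem
    refine ⟨r, hr, fun x => ?_⟩
    have h1 := abs_lt.1 (hpq x)
    have h2 := abs_lt.1 (hrq x)
    rw [abs_le]
    constructor <;> linarith
  have hsum : ENNReal.ofReal (n * (gA.toReal + η) + (gB.toReal + η) +
      ((gapInf LC UX).toReal + η) + ((gapInf LX UC).toReal + η)) ≤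
      (n : ℝ≥0∞) * gA + gB + gapInf LC UX + gapInf LX UC + ε := by
    have he : n * (gA.toReal + η) + (gB.toReal + η) + ((gapInf LC UX).toReal + η) +
        ((gapInf LX UC).toReal + η) = n * gA.toReal + gB.toReal + (gapInf LC UX).toReal +
          (gapInf LX UC).toReal + ε := by
      have : (n + 3) * η = ε := by
        rw [hη]
        field_simp
      linarith
    rw [he]
    refine ENNReal.ofReal_add_le.trans (add_le_add ?_ ENNReal.ofReal_coe_nnreal.le)
    refine ENNReal.ofReal_add_le.trans (add_le_add ?_ ENNReal.ofReal_toReal_le)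
    refine ENNReal.ofReal_add_le.trans (add_le_add ?_ ENNReal.ofReal_toReal_le)
    refine ENNReal.ofReal_add_le.trans (add_le_add ?_ ENNReal.ofReal_toReal_le)
    rw [ENNReal.ofReal_mul (Nat.cast_nonneg n), ENNReal.ofReal_natCast]
    gcongr
    exact ENNReal.ofReal_toReal_le
  refine le_trans ?_ hsum
  refine iSup_le fun k => iSup₂_le fun p hp => ?_
  obtain ⟨r, hr, hpr⟩ := hpoint k p hp
  refine iInf₂_le_of_le r hr (iSup_le fun x => ?_)
  rw [edist_dist, Real.dist_eq]
  exact ENNReal.ofReal_le_ofReal (hpr x)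
end
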